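/- Assume that at every point of Γ_T := {(x,t) : x ∈ Γ(t), 0 < t < T} the continuity equation D_t ρ + (div_Γ v) ρ = 0 and the momentum equation ρ D_t v = div_Γ S_Γ(v,σ) + ρ F hold, where S_Γ(v,σ) = e₁'(|D_Γ(v)|²) D_Γ(v) + e₂'(|div_Γ v|²)(div_Γ v) P_Γ − σ P_Γ. Assume further that either S_Γ(v,σ)(x,t) ν(x,t) = 0 for H¹-a.e. x ∈ ∂Γ(t) for every t ∈ (0,T), or v(x,t) = 0 for every x ∈ ∂Γ(t) and t ∈ (0,T). Then for all 0 < t₁ < t₂ < T: ∫_{Γ(t₂)} ½ ρ|v|² dH² + ∫_{t₁}^{t₂} ∫_{Γ(τ)} ẽ_D dH² dτ = ∫_{Γ(t₁)} ½ ρ|v|² dH² + ∫_{t₁}^{t₂} ∫_{Γ(τ)} { (div_Γ v) σ + ρ F · v } dH² dτ, where ẽ_D = e₁'(|D_Γ(v)|²)|D_Γ(v)|² + e₂'(|div_Γ v|²)|div_Γ v|². -/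

import Mathlib

noncomputable section
open MeasureTheory

/-- ℝ² with the Euclidean structure. -/
abbrev E2 : Type := EuclideanSpace ℝ (Fin 2)
/-- ℝ³ with the Euclidean structure. -/
abbrev E3 : Type := EuclideanSpace ℝ (Fin 3)

/-- The cross product on ℝ³. -/
def cross3 (a b : E3) : E3 :=
  (EuclideanSpace.equiv (Fin 3) ℝ).symm
    ![a 1 * b 2 - a 2 * b 1, a 2 * b 0 - a 0 * b 2, a 0 * b 1 - a 1 * b 0]

/-- The dot product on ℝ³. -/
def dot3 (a b : E3) : ℝ := ∑ i, a i * b i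

/-- The tangent vector `g_α = ∂x̂/∂X_α` of the parametrization `x̂` at `(X, t)`. -/
def gVec (xh : E2 × ℝ → E3) (α : Fin 2) (X : E2) (t : ℝ) : E3 :=
  fderiv ℝ (fun Y : E2 => xh (Y, t)) X (EuclideanSpace.single α 1)

/-- The Riemannian metric `g_{αβ} = g_α · g_β`. -/
def gMet (xh : E2 × ℝ → E3) (α β : Fin 2) (X : E2) (t : ℝ) : ℝ :=
  dot3 (gVec xh α X t) (gVec xh β X t)

/-- The Gram determinant `G = g₁₁ g₂₂ − g₁₂ g₂₁`. -/
def Gdet (xh : E2 × ℝ → E3) (X : E2) (t : ℝ) : ℝ :=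
  gMet xh 0 0 X t * gMet xh 1 1 X t - gMet xh 0 1 X t * gMet xh 1 0 X t

/-- The inverse metric `(g^{αβ}) = (g_{αβ})⁻¹`. -/
def gInv (xh : E2 × ℝ → E3) (X : E2) (t : ℝ) : Matrix (Fin 2) (Fin 2) ℝ :=
  (Matrix.of fun α β => gMet xh α β X t)⁻¹

/-- The raised tangent vector `g^α = Σ_β g^{αβ} g_β`. -/
def gVecUp (xh : E2 × ℝ → E3) (α : Fin 2) (X : E2) (t : ℝ) : E3 :=
  ∑ β, gInv xh X t α β • gVec xh β X t

/-- The unit normal `n̂ = (g₁ × g₂)/|g₁ × g₂|` of the parametrized surface. -/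
def nHat (xh : E2 × ℝ → E3) (X : E2) (t : ℝ) : E3 :=
  ‖cross3 (gVec xh 0 X t) (gVec xh 1 X t)‖⁻¹ • cross3 (gVec xh 0 X t) (gVec xh 1 X t)

/-- Spatial partial derivative `∂f/∂x_j` at `(x, t)`. -/
def pdx (j : Fin 3) (f : E3 × ℝ → ℝ) (x : E3) (t : ℝ) : ℝ :=
  fderiv ℝ (fun y : E3 => f (y, t)) x (EuclideanSpace.single j 1)

/-- Time partial derivative `∂f/∂t` at `(x, t)`. -/
def pdt (f : E3 × ℝ → ℝ) (x : E3) (t : ℝ) : ℝ := deriv (fun s => f (x, s)) t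

/-- Tangential derivative `∂_j^Γ f = Σ_i (δ_{ij} − N_i N_j) ∂f/∂x_i`
with normal extension `N`. -/
def tder (N : E3 × ℝ → E3) (j : Fin 3) (f : E3 × ℝ → ℝ) (x : E3) (t : ℝ) : ℝ :=
  ∑ i, ((if i = j then (1 : ℝ) else 0) - N (x, t) i * N (x, t) j) * pdx i f x t

/-- Surface gradient `grad_Γ f = (∂_1^Γ f, ∂_2^Γ f, ∂_3^Γ f)`. -/
def sgrad (N : E3 × ℝ → E3) (f : E3 × ℝ → ℝ) (x : E3) (t : ℝ) : E3 :=
  (EuclideanSpace.equiv (Fin 3) ℝ).symm fun j => tder N j f x t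

/-- Surface divergence `div_Γ φ = Σ_j ∂_j^Γ φ_j`. -/
def sdiv (N : E3 × ℝ → E3) (φ : E3 × ℝ → E3) (x : E3) (t : ℝ) : ℝ :=
  ∑ j, tder N j (fun p => φ p j) x t

/-- Row-wise surface divergence of a matrix field: `(div_Γ M)_i = Σ_j ∂_j^Γ M_{ij}`. -/
def sdivM (N : E3 × ℝ → E3) (M : E3 × ℝ → Matrix (Fin 3) (Fin 3) ℝ) (x : E3) (t : ℝ) : E3 :=
  (EuclideanSpace.equiv (Fin 3) ℝ).symm fun i => ∑ j, tder N j (fun p => M p i j) x t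

/-- The orthogonal projection matrix `P_Γ = I − N ⊗ N`. -/
def Pmat (N : E3 × ℝ → E3) (x : E3) (t : ℝ) : Matrix (Fin 3) (Fin 3) ℝ :=
  Matrix.of fun i j => (if i = j then (1 : ℝ) else 0) - N (x, t) i * N (x, t) j

/-- The symmetric gradient `D(φ) = ((∇φ) + (∇φ)ᵀ)/2`. -/
def Dmat (φ : E3 × ℝ → E3) (x : E3) (t : ℝ) : Matrix (Fin 3) (Fin 3) ℝ :=
  Matrix.of fun i j => (pdx i (fun p => φ p j) x t + pdx j (fun p => φ p i) x t) / 2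

/-- The surface stretching tensor `D_Γ(φ) = P_Γ D(φ) P_Γ`. -/
def DGam (N : E3 × ℝ → E3) (φ : E3 × ℝ → E3) (x : E3) (t : ℝ) : Matrix (Fin 3) (Fin 3) ℝ :=
  Pmat N x t * Dmat φ x t * Pmat N x t

/-- The squared Frobenius norm `|M|² = Σ_{i,j} M_{ij}²`. -/
def frob2 (M : Matrix (Fin 3) (Fin 3) ℝ) : ℝ := ∑ i, ∑ j, (M i j) ^ 2

/-- The material derivative `D_t f = ∂_t f + (v · ∇)f`. -/
def Dt (v : E3 × ℝ → E3) (f : E3 × ℝ → ℝ) (x : E3) (t : ℝ) : ℝ :=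
  pdt f x t + ∑ i, v (x, t) i * pdx i f x t

/-- Matrix-vector product on ℝ³. -/
def mulVec3 (M : Matrix (Fin 3) (Fin 3) ℝ) (w : E3) : E3 :=
  (EuclideanSpace.equiv (Fin 3) ℝ).symm (M.mulVec fun i => w i)

/-- The dot product on ℝ². -/
def dot2 (a b : E2) : ℝ := ∑ i, a i * b i

/-- The unit outer co-normal
`ν = ((n₁^U g₂ − n₂^U g₁)/|n₁^U g₂ − n₂^U g₁|) × n̂` at the boundary point `x̂(X,t)`,
where `n^U` is the unit outer normal of `U ⊆ ℝ²`. -/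
def conormal (xh : E2 × ℝ → E3) (nU : E2 → E2) (X : E2) (t : ℝ) : E3 :=
  cross3 (‖nU X 0 • gVec xh 1 X t - nU X 1 • gVec xh 0 X t‖⁻¹ •
      (nU X 0 • gVec xh 1 X t - nU X 1 • gVec xh 0 X t)) (nHat xh X t)

/-- `nU` is (H¹-a.e. on `∂U`) the unit outer normal of the bounded domain `U`:
it has unit length and satisfies the Gauss–Green formula on `U`. -/
def IsUnitOuterNormal (U : Set E2) (nU : E2 → E2) : Prop :=
  (∀ᵐ X ∂((μH[1] : Measure E2).restrict (frontier U)), ‖nU X‖ = 1) ∧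
  ∀ ψ : E2 → E2, ContDiff ℝ 1 ψ →
    (∫ X in U, ∑ α : Fin 2, fderiv ℝ (fun Y : E2 => ψ Y α) X (EuclideanSpace.single α 1))
      = ∫ X in frontier U, dot2 (ψ X) (nU X) ∂(μH[1] : Measure E2)

/-- The generalized surface stress tensor
`S_Γ(v,σ) = e₁'(|D_Γ(v)|²) D_Γ(v) + e₂'(|div_Γ v|²)(div_Γ v) P_Γ − σ P_Γ`. -/
def SGam (N : E3 × ℝ → E3) (v : E3 × ℝ → E3) (σ : E3 × ℝ → ℝ) (e₁ e₂ : ℝ → ℝ)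
    (x : E3) (t : ℝ) : Matrix (Fin 3) (Fin 3) ℝ :=
  deriv e₁ (frob2 (DGam N v x t)) • DGam N v x t
    + (deriv e₂ ((sdiv N v x t) ^ 2) * sdiv N v x t) • Pmat N x t
    - σ (x, t) • Pmat N x t

/-- The generalized density of energy dissipation
`ẽ_D = e₁'(|D_Γ(v)|²)|D_Γ(v)|² + e₂'(|div_Γ v|²)|div_Γ v|²`. -/
def eDtilde (N : E3 × ℝ → E3) (v : E3 × ℝ → E3) (e₁ e₂ : ℝ → ℝ) (x : E3) (t : ℝ) : ℝ :=
  deriv e₁ (frob2 (DGam N v x t)) * frob2 (DGam N v x t)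
    + deriv e₂ ((sdiv N v x t) ^ 2) * (sdiv N v x t) ^ 2

section AreaFormula

open Set Filter Topology Module
open scoped NNReal ENNReal

/-- A local comparison of measures on a second countable space is a global one. -/
theorem measure_le_of_forall_exists_nhds {α : Type*} [TopologicalSpace α]
    [SecondCountableTopology α] [MeasurableSpace α] [OpensMeasurableSpace α] {μ ν : Measure α}
    (h : ∀ x, ∃ V ∈ 𝓝 x, ∀ s ⊆ V, MeasurableSet s → μ s ≤ ν s) : μ ≤ ν := by
  have h' : ∀ x, ∃ V, (IsOpen V ∧ x ∈ V) ∧ ∀ s ⊆ V, MeasurableSet s → μ s ≤ ν s := by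
    intro x
    obtain ⟨V, hV, hs⟩ := h x
    obtain ⟨O, hOV, hO, hx⟩ := mem_nhds_iff.1 hV
    exact ⟨O, ⟨hO, hx⟩, fun s hsO hm => hs s (hsO.trans hOV) hm⟩
  choose V hV hle using h'
  obtain ⟨t, ht, htU⟩ := TopologicalSpace.countable_cover_nhds
    fun x => (hV x).1.mem_nhds (hV x).2
  rw [Measure.le_iff]
  intro s hs
  rcases t.eq_empty_or_nonempty with rfl | hne
  · have : s = ∅ := by
      have h0 : (univ : Set α) = ∅ := by simpa using htU.symm
      exact subset_empty_iff.1 (h0 ▸ subset_univ s)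
    simp [this]
  obtain ⟨x, rfl⟩ := ht.exists_eq_range hne
  have hcover : ⋃ n, disjointed (fun n => V (x n)) n = univ := by
    rw [iUnion_disjointed, ← htU, biUnion_range]
  have hmeas : ∀ n, MeasurableSet (disjointed (fun n => V (x n)) n) :=
    MeasurableSet.disjointed fun n => (hV (x n)).1.measurableSet
  have hdec : s = ⋃ n, s ∩ disjointed (fun n => V (x n)) n := by
    rw [← inter_iUnion, hcover, inter_univ]
  have hdisj : Pairwise (Function.onFun Disjoint
      fun n => s ∩ disjointed (fun n => V (x n)) n) := fun i j hij =>
    (disjoint_disjointed _ hij).mono inter_subset_right inter_subset_right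
  rw [hdec, measure_iUnion hdisj fun n => hs.inter (hmeas n),
    measure_iUnion hdisj fun n => hs.inter (hmeas n)]
  exact ENNReal.tsum_le_tsum fun n =>
    hle (x n) _ (inter_subset_right.trans (disjointed_subset _ _)) (hs.inter (hmeas n))

theorem hausdorffMeasure_image_le_of_dist_le {X Y Z : Type*} [MetricSpace X] [MetricSpace Y]
    [MetricSpace Z] [MeasurableSpace Y] [BorelSpace Y] [MeasurableSpace Z] [BorelSpace Z]
    {f : X → Y} {g : X → Z} {s : Set X} {L : ℝ≥0} {d : ℕ}
    (h : ∀ x ∈ s, ∀ y ∈ s, dist (g x) (g y) ≤ L * dist (f x) (f y)) :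
    μH[d] (g '' s) ≤ (L : ℝ≥0∞) ^ d * μH[d] (f '' s) := by
  rcases s.eq_empty_or_nonempty with rfl | ⟨x₀, hx₀⟩
  · simp
  have : Nonempty X := ⟨x₀⟩
  have hinv : ∀ x ∈ s, g (Function.invFunOn f s (f x)) = g x := by
    intro x hx
    have hm : ∃ a ∈ s, f a = f x := ⟨x, hx, rfl⟩
    have := h _ (Function.invFunOn_mem hm) x hx
    rw [Function.invFunOn_eq hm, dist_self, mul_zero] at this
    exact dist_le_zero.1 this
  have hlip : LipschitzOnWith L (fun y => g (Function.invFunOn f s y)) (f '' s) := by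
    refine LipschitzOnWith.of_dist_le_mul ?_
    rintro _ ⟨x, hx, rfl⟩ _ ⟨y, hy, rfl⟩
    rw [hinv x hx, hinv y hy]
    exact h x hx y hy
  have himg : g '' s = (fun y => g (Function.invFunOn f s y)) '' (f '' s) := by
    rw [image_image]
    exact image_congr fun x hx => (hinv x hx).symm
  rw [himg]
  simpa using hlip.hausdorffMeasure_image_le (d := d) (by positivity)

variable {E V : Type*} [NormedAddCommGroup E] [InnerProductSpace ℝ E] [FiniteDimensional ℝ E]
  [NormedAddCommGroup V] [InnerProductSpace ℝ V]

theorem continuous_normDet : Continuous fun A : E →L[ℝ] V => A.toLinearMap.normDet := by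
  have h : (fun A : E →L[ℝ] V => A.toLinearMap.normDet) =
      fun A => √((Matrix.gram ℝ fun i => A (stdOrthonormalBasis ℝ E i)).det) := by
    funext A
    have := A.toLinearMap.normDet_sq_eq_det_gram (stdOrthonormalBasis ℝ E)
    simp only [RCLike.ofReal_real_eq_id, id] at this
    rw [← Real.sqrt_sq A.toLinearMap.normDet_nonneg, this]
    rfl
  rw [h]
  refine Real.continuous_sqrt.comp (Continuous.matrix_det ?_)
  refine continuous_matrix fun i j => ?_
  simp only [Matrix.gram_apply]
  fun_prop

/-- Near a point at which the derivative is injective, a map distorts distances like the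
derivative, up to a factor close to one. -/
theorem HasStrictFDerivAt.exists_nhds_dist_le {f : E → V} {A : E →L[ℝ] V} {x : E}
    (hf : HasStrictFDerivAt f A x) (hA : LinearMap.ker A.toLinearMap = ⊥) {L : ℝ≥0} (hL : 1 < L) :
    ∃ s ∈ 𝓝 x, ∀ y ∈ s, ∀ z ∈ s, dist (f y) (f z) ≤ L * dist (A y) (A z) ∧
      dist (A y) (A z) ≤ L * dist (f y) (f z) := by
  obtain ⟨K, hK, hanti⟩ := LinearMap.exists_antilipschitzWith A.toLinearMap hA
  have hL0 : (0 : ℝ) < L := by exact_mod_cast zero_lt_one.trans hL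
  have hL1 : (1 : ℝ) < L := by exact_mod_cast hL
  have hKr : (0 : ℝ) < K := by exact_mod_cast hK
  have hc : (0 : ℝ) < (1 - (L : ℝ)⁻¹) / K := by
    have := inv_lt_one_of_one_lt₀ hL1
    exact div_pos (by linarith) hKr
  obtain ⟨s, hs, happ⟩ := hf.approximates_deriv_on_nhds (c := ⟨_, hc.le⟩) (Or.inr hc)
  refine ⟨s, hs, fun y hy z hz => ?_⟩
  have h1 : ‖f y - f z - A (y - z)‖ ≤ (1 - (L : ℝ)⁻¹) / K * ‖y - z‖ := happ y hy z hz
  have h2 : ‖y - z‖ ≤ K * ‖A (y - z)‖ := by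
    have := hanti.le_mul_dist y z
    simpa [dist_eq_norm] using this
  have h3 : ‖f y - f z - A (y - z)‖ ≤ (1 - (L : ℝ)⁻¹) * ‖A (y - z)‖ := by
    refine h1.trans ((mul_le_mul_of_nonneg_left h2 hc.le).trans_eq ?_)
    field_simp
  rw [dist_eq_norm, dist_eq_norm, ← map_sub]
  have h4 := norm_sub_norm_le (f y - f z) (A (y - z))
  have h5 := norm_sub_norm_le (A (y - z)) (f y - f z)
  rw [norm_sub_rev (A (y - z))] at h5
  have h6 : 2 - (L : ℝ)⁻¹ ≤ L := by
    have : (L : ℝ) * (L : ℝ)⁻¹ = 1 := mul_inv_cancel₀ hL0.ne'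
    nlinarith [sq_nonneg ((L : ℝ) - 1), inv_pos.2 hL0]
  constructor
  · nlinarith [mul_le_mul_of_nonneg_right h6 (norm_nonneg (A (y - z)))]
  · have : (L : ℝ)⁻¹ * ‖A (y - z)‖ ≤ ‖f y - f z‖ := by linarith
    rwa [inv_mul_le_iff₀ hL0] at this

variable [MeasurableSpace E] [BorelSpace E] [MeasurableSpace V] [BorelSpace V]

/-- The local form of the area formula. -/
theorem exists_nhds_hausdorffMeasure_image_le {f : E → V} (hf : ContDiff ℝ 1 f) {x : E}
    (hx : 0 < (fderiv ℝ f x).toLinearMap.normDet) {L : ℝ≥0} (hL : 1 < L) :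
    ∃ s ∈ 𝓝 x, ∀ t ⊆ s, MeasurableSet t →
      μH[finrank ℝ E] (f '' t) ≤ (L : ℝ≥0∞) ^ (finrank ℝ E + 1) *
        ∫⁻ y in t, ENNReal.ofReal (fderiv ℝ f y).toLinearMap.normDet ∂μH[finrank ℝ E] ∧
      ∫⁻ y in t, ENNReal.ofReal (fderiv ℝ f y).toLinearMap.normDet ∂μH[finrank ℝ E] ≤
        (L : ℝ≥0∞) ^ (finrank ℝ E + 1) * μH[finrank ℝ E] (f '' t) := by
  set A := fderiv ℝ f x with hA
  set d := finrank ℝ E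
  have hker : LinearMap.ker A.toLinearMap = ⊥ := by
    by_contra h
    exact hx.ne' (LinearMap.normDet_eq_zero_iff_ker_ne_bot.2 h)
  obtain ⟨s, hs, hdist⟩ := (hf.hasStrictFDerivAt (x := x) one_ne_zero).exists_nhds_dist_le hker hL
  have hJ : Continuous fun y => (fderiv ℝ f y).toLinearMap.normDet :=
    continuous_normDet.comp (hf.continuous_fderiv one_ne_zero)
  have hL1 : (1 : ℝ) < L := by exact_mod_cast hL
  have hlt1 : A.toLinearMap.normDet < L * (fderiv ℝ f x).toLinearMap.normDet := by
    rw [← hA]; nlinarith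
  have hlt2 : (fderiv ℝ f x).toLinearMap.normDet < L * A.toLinearMap.normDet := by
    rw [← hA]; nlinarith
  have hn1 := (continuous_const.mul hJ).continuousAt.eventually (lt_mem_nhds hlt1)
  have hn2 := hJ.continuousAt.eventually (gt_mem_nhds hlt2)
  refine ⟨_, inter_mem hs (hn1.and hn2), fun t ht htm => ?_⟩
  have himg : μH[d] (A '' t) = ENNReal.ofReal A.toLinearMap.normDet * μH[d] t :=
    A.toLinearMap.hausdorffMeasure_image t
  have hconst : ENNReal.ofReal A.toLinearMap.normDet * μH[d] t =
      ∫⁻ _ in t, ENNReal.ofReal A.toLinearMap.normDet ∂μH[d] := by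
    rw [setLIntegral_const]
  have hm : Measurable fun y => ENNReal.ofReal (fderiv ℝ f y).toLinearMap.normDet :=
    hJ.measurable.ennreal_ofReal
  have hLe : ENNReal.ofReal (L : ℝ) = L := ENNReal.ofReal_coe_nnreal
  constructor
  · calc μH[d] (f '' t) ≤ (L : ℝ≥0∞) ^ d * μH[d] (A '' t) :=
          hausdorffMeasure_image_le_of_dist_le fun y hy z hz =>
            (hdist y (ht hy).1 z (ht hz).1).1
      _ ≤ (L : ℝ≥0∞) ^ d * (L *
          ∫⁻ y in t, ENNReal.ofReal (fderiv ℝ f y).toLinearMap.normDet ∂μH[d]) := by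
        rw [himg, hconst, ← lintegral_const_mul _ hm]
        refine mul_le_mul_right (setLIntegral_mono' htm fun y hy => ?_) _
        rw [← hLe, ← ENNReal.ofReal_mul (by positivity)]
        exact ENNReal.ofReal_le_ofReal (ht hy).2.1.le
      _ = _ := by rw [pow_succ, mul_assoc]
  · calc ∫⁻ y in t, ENNReal.ofReal (fderiv ℝ f y).toLinearMap.normDet ∂μH[d]
        ≤ L * μH[d] (A '' t) := by
          rw [himg, hconst, ← lintegral_const_mul _ measurable_const]
          refine setLIntegral_mono' htm fun y hy => ?_
          rw [← hLe, ← ENNReal.ofReal_mul (by positivity)]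
          exact ENNReal.ofReal_le_ofReal (ht hy).2.2.le
      _ ≤ L * ((L : ℝ≥0∞) ^ d * μH[d] (f '' t)) := by
        refine mul_le_mul_right ?_ _
        exact hausdorffMeasure_image_le_of_dist_le fun y hy z hz =>
          (hdist y (ht hy).1 z (ht hz).1).2
      _ = _ := by rw [pow_succ', mul_assoc]

/-- The **area formula** for an injective immersion, as an identity of measures. -/
theorem comap_hausdorffMeasure_eq {f : E → V} (hf : ContDiff ℝ 1 f) {U : Set E} (hU : IsOpen U)
    (hinj : InjOn f U) (hpos : ∀ x ∈ U, 0 < (fderiv ℝ f x).toLinearMap.normDet) :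
    (μH[finrank ℝ E] : Measure V).comap (U.domRestrict f) =
      ((μH[finrank ℝ E] : Measure E).withDensity
        fun y => ENNReal.ofReal (fderiv ℝ f y).toLinearMap.normDet).comap
        (Subtype.val : U → E) := by
  have hemb : MeasurableEmbedding (U.domRestrict f) :=
    hf.continuous.continuousOn.measurableEmbedding hU.measurableSet hinj
  have hval : MeasurableEmbedding (Subtype.val : U → E) :=
    MeasurableEmbedding.subtype_coe hU.measurableSet
  set d := finrank ℝ E
  set μ := (μH[d] : Measure V).comap (U.domRestrict f)
  set ν := ((μH[d] : Measure E).withDensity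
    fun y => ENNReal.ofReal (fderiv ℝ f y).toLinearMap.normDet).comap (Subtype.val : U → E)
  have hμ : ∀ s, μ s = μH[d] (f '' (Subtype.val '' s)) := fun s => by
    rw [hemb.comap_apply, image_image]; rfl
  have hν : ∀ s, MeasurableSet s → ν s = ∫⁻ y in Subtype.val '' s,
      ENNReal.ofReal (fderiv ℝ f y).toLinearMap.normDet ∂μH[d] := fun s hs => by
    rw [hval.comap_apply, withDensity_apply _ (hval.measurableSet_image.2 hs)]
  have hlocal : ∀ L : ℝ≥0, 1 < L →
      μ ≤ (L : ℝ≥0∞) ^ (d + 1) • ν ∧ ν ≤ (L : ℝ≥0∞) ^ (d + 1) • μ := by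
    intro L hL
    constructor <;>
    · refine measure_le_of_forall_exists_nhds fun x => ?_
      obtain ⟨s, hs, hle⟩ := exists_nhds_hausdorffMeasure_image_le hf (hpos x x.2) hL
      refine ⟨Subtype.val ⁻¹' s, continuous_subtype_val.continuousAt.preimage_mem_nhds hs,
        fun t ht htm => ?_⟩
      have := hle _ (image_subset_iff.2 ht) (hval.measurableSet_image.2 htm)
      rw [Measure.smul_apply, hμ, hν t htm, smul_eq_mul]
      first | exact this.1 | exact this.2
  have hlim : ∀ a : ℝ≥0∞, Tendsto (fun L : ℝ≥0 => (L : ℝ≥0∞) ^ (d + 1) * a) (𝓝[>] 1) (𝓝 a) := by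
    intro a
    have hp : Tendsto (fun L : ℝ≥0 => (L : ℝ≥0∞) ^ (d + 1)) (𝓝[>] 1) (𝓝 1) := by
      have : Continuous fun L : ℝ≥0 => (L : ℝ≥0∞) ^ (d + 1) :=
        (ENNReal.continuous_pow _).comp ENNReal.continuous_coe
      simpa using (this.tendsto 1).mono_left nhdsWithin_le_nhds
    simpa using ENNReal.Tendsto.mul_const hp (Or.inl one_ne_zero)
  refine Measure.ext fun s _ => le_antisymm ?_ ?_
  · exact ge_of_tendsto (hlim (ν s)) (eventually_nhdsWithin_of_forall
      fun L hL => (hlocal L hL).1 s)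
  · exact ge_of_tendsto (hlim (μ s)) (eventually_nhdsWithin_of_forall
      fun L hL => (hlocal L hL).2 s)

/-- The **area formula** for the Hausdorff measure on the image of an injective immersion. -/
theorem setIntegral_image_hausdorffMeasure {f : E → V} (hf : ContDiff ℝ 1 f) {U : Set E}
    (hU : IsOpen U) (hinj : InjOn f U)
    (hpos : ∀ x ∈ U, 0 < (fderiv ℝ f x).toLinearMap.normDet) (g : V → ℝ) :
    ∫ y in f '' U, g y ∂μH[finrank ℝ E] =
      ∫ x in U, (fderiv ℝ f x).toLinearMap.normDet * g (f x) ∂μH[finrank ℝ E] := by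
  have hemb : MeasurableEmbedding (U.domRestrict f) :=
    hf.continuous.continuousOn.measurableEmbedding hU.measurableSet hinj
  have hJ : Measurable fun y => Real.toNNReal (fderiv ℝ f y).toLinearMap.normDet :=
    (continuous_normDet.comp (hf.continuous_fderiv one_ne_zero)).measurable.real_toNNReal
  have hrange : range (U.domRestrict f) = f '' U := by
    rw [domRestrict_eq, range_comp, Subtype.range_coe]
  rw [← hrange, ← hemb.map_comap, hemb.integral_map, comap_hausdorffMeasure_eq hf hU hinj hpos]
  refine (integral_subtype_comap hU.measurableSet fun x => g (f x)).trans ?_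
  refine (setIntegral_withDensity_eq_setIntegral_smul hJ _ hU.measurableSet).trans ?_
  refine setIntegral_congr_fun hU.measurableSet fun x hx => ?_
  simp [NNReal.smul_def, Real.coe_toNNReal _ (hpos x hx).le]

end AreaFormula

section Parametrization

open Set Filter Topology

theorem cross3_apply_zero (a b : E3) : cross3 a b 0 = a 1 * b 2 - a 2 * b 1 := rfl

theorem cross3_apply_one (a b : E3) : cross3 a b 1 = a 2 * b 0 - a 0 * b 2 := rfl

theorem cross3_apply_two (a b : E3) : cross3 a b 2 = a 0 * b 1 - a 1 * b 0 := rfl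

theorem norm_sq_eq_sum (a : E3) : ‖a‖ ^ 2 = ∑ i, a i * a i := by
  rw [EuclideanSpace.real_norm_sq_eq]
  simp only [pow_two]

theorem norm_cross3_sq (a b : E3) :
    ‖cross3 a b‖ ^ 2 = dot3 a a * dot3 b b - dot3 a b * dot3 b a := by
  simp only [norm_sq_eq_sum, dot3, Fin.sum_univ_three, cross3_apply_zero, cross3_apply_one,
    cross3_apply_two]
  ring

/-- The area element `√G = |g₁ × g₂|`. -/
def areaElem (xh : E2 × ℝ → E3) (X : E2) (t : ℝ) : ℝ :=
  ‖cross3 (gVec xh 0 X t) (gVec xh 1 X t)‖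

theorem areaElem_sq (xh : E2 × ℝ → E3) (X : E2) (t : ℝ) : areaElem xh X t ^ 2 = Gdet xh X t :=
  norm_cross3_sq _ _

theorem areaElem_pos {xh : E2 × ℝ → E3} {X : E2} {t : ℝ} (h : 0 < Gdet xh X t) :
    0 < areaElem xh X t := by
  rw [← areaElem_sq] at h
  exact (norm_nonneg _).lt_of_ne fun h0 => by simp [areaElem, ← h0] at h

theorem normDet_eq_norm_cross3 (A : E2 →L[ℝ] E3) :
    A.toLinearMap.normDet =
      ‖cross3 (A (EuclideanSpace.single 0 1)) (A (EuclideanSpace.single 1 1))‖ := by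
  rw [← sq_eq_sq₀ (LinearMap.normDet_nonneg _) (norm_nonneg _), norm_cross3_sq]
  have := A.toLinearMap.normDet_sq_eq_det_gram (EuclideanSpace.basisFun (Fin 2) ℝ)
  simp only [RCLike.ofReal_real_eq_id, id] at this
  rw [this, Matrix.det_fin_two]
  have hinner : ∀ a b : E3, inner ℝ a b = dot3 a b := fun a b => by
    simp [dot3, PiLp.inner_apply, Fin.sum_univ_three, mul_comm]
  simp only [Matrix.gram_apply, hinner, EuclideanSpace.basisFun_apply]
  rfl

/-- The area formula for parametrized surfaces; the factor `c` relates the two-dimensional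
Hausdorff measure to the Lebesgue measure of the plane. -/
theorem exists_setIntegral_surface :
    ∃ c : ℝ, ∀ (xh : E2 × ℝ → E3) (U : Set E2) (t : ℝ), ContDiff ℝ 1 xh → IsOpen U →
      InjOn (fun X => xh (X, t)) U → (∀ X ∈ U, 0 < Gdet xh X t) → ∀ g : E3 → ℝ,
      ∫ x in (fun X => xh (X, t)) '' U, g x ∂(μH[2] : Measure E3) =
        c * ∫ X in U, areaElem xh X t * g (xh (X, t)) := by
  have hd : ((Module.finrank ℝ E2 : ℕ) : ℝ) = 2 := by simp
  have : (μH[2] : Measure E2).IsAddHaarMeasure := by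
    rw [← hd]; infer_instance
  refine ⟨(Measure.addHaarScalarFactor (μH[2] : Measure E2) volume : ℝ),
    fun xh U t hxh hU hinj hG g => ?_⟩
  have hf : ContDiff ℝ 1 fun X => xh (X, t) := hxh.comp (contDiff_prodMk_left t)
  have hJ : ∀ X, (fderiv ℝ (fun X => xh (X, t)) X).toLinearMap.normDet = areaElem xh X t :=
    fun X => normDet_eq_norm_cross3 _
  have := setIntegral_image_hausdorffMeasure hf hU hinj
    (fun X hX => by rw [hJ]; exact areaElem_pos (hG X hX)) g
  simp only [hJ, hd] at this
  conv_lhs => rw [this, Measure.isAddLeftInvariant_eq_smul (μH[2] : Measure E2) volume,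
    Measure.restrict_smul, integral_smul_nnreal_measure]
  rfl

/-! ### Smoothness of the coordinate expressions -/

theorem contDiff_apply₃ {X : Type*} [NormedAddCommGroup X] [NormedSpace ℝ X] {n : ℕ∞}
    {f : X → E3} (hf : ContDiff ℝ n f) (i : Fin 3) : ContDiff ℝ n fun x => f x i :=
  contDiff_euclidean.1 hf i

theorem pdx_eq {φ : E3 × ℝ → ℝ} {x : E3} {t : ℝ} (h : DifferentiableAt ℝ φ (x, t)) (j : Fin 3) :
    pdx j φ x t = fderiv ℝ φ (x, t) (EuclideanSpace.single j 1, 0) := by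
  have := HasFDerivAt.comp (f := fun y : E3 => (y, t)) x h.hasFDerivAt (hasFDerivAt_prodMk_left x t)
  exact congrArg (fun A => A (EuclideanSpace.single j 1)) this.fderiv

theorem pdt_eq {φ : E3 × ℝ → ℝ} {x : E3} {t : ℝ} (h : DifferentiableAt ℝ φ (x, t)) :
    pdt φ x t = fderiv ℝ φ (x, t) (0, 1) := by
  have := HasFDerivAt.comp t h.hasFDerivAt (hasFDerivAt_prodMk_right x t)
  exact this.hasDerivAt.deriv

theorem gVec_eq {xh : E2 × ℝ → E3} {X : E2} {t : ℝ} (h : DifferentiableAt ℝ xh (X, t))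
    (α : Fin 2) : gVec xh α X t = fderiv ℝ xh (X, t) (EuclideanSpace.single α 1, 0) := by
  have := HasFDerivAt.comp (f := fun Y : E2 => (Y, t)) X h.hasFDerivAt (hasFDerivAt_prodMk_left X t)
  exact congrArg (fun A => A (EuclideanSpace.single α 1)) this.fderiv

theorem contDiff_pdx {φ : E3 × ℝ → ℝ} {n : ℕ∞} (h : ContDiff ℝ (n + 1) φ) (j : Fin 3) :
    ContDiff ℝ n fun p : E3 × ℝ => pdx j φ p.1 p.2 := by
  have hd : Differentiable ℝ φ := h.differentiable (by simp)
  simp only [fun p : E3 × ℝ => pdx_eq (hd (p.1, p.2)) j]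
  exact (h.fderiv_right le_rfl).clm_apply contDiff_const

theorem contDiff_gVec {xh : E2 × ℝ → E3} {n : ℕ∞} (h : ContDiff ℝ (n + 1) xh) (α : Fin 2) :
    ContDiff ℝ n fun q : E2 × ℝ => gVec xh α q.1 q.2 := by
  have hd : Differentiable ℝ xh := h.differentiable (by simp)
  simp only [fun q : E2 × ℝ => gVec_eq (hd (q.1, q.2)) α]
  exact (h.fderiv_right le_rfl).clm_apply contDiff_const

theorem contDiff_cross3 {X : Type*} [NormedAddCommGroup X] [NormedSpace ℝ X] {n : ℕ∞}
    {a b : X → E3} (ha : ContDiff ℝ n a) (hb : ContDiff ℝ n b) :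
    ContDiff ℝ n fun x => cross3 (a x) (b x) := by
  have ha' := contDiff_apply₃ ha
  have hb' := contDiff_apply₃ hb
  refine contDiff_euclidean.2 fun i => ?_
  fin_cases i
  · exact ((ha' 1).mul (hb' 2)).sub ((ha' 2).mul (hb' 1))
  · exact ((ha' 2).mul (hb' 0)).sub ((ha' 0).mul (hb' 2))
  · exact ((ha' 0).mul (hb' 1)).sub ((ha' 1).mul (hb' 0))

theorem contDiff_tder {N : E3 × ℝ → E3} {φ : E3 × ℝ → ℝ} {n : ℕ∞} (hN : ContDiff ℝ n N)
    (h : ContDiff ℝ (n + 1) φ) (j : Fin 3) : ContDiff ℝ n fun p : E3 × ℝ => tder N j φ p.1 p.2 :=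
  ContDiff.sum fun i _ => (contDiff_const.sub
    ((contDiff_apply₃ hN i).mul (contDiff_apply₃ hN j))).mul (contDiff_pdx h i)

theorem contDiff_sdiv {N φ : E3 × ℝ → E3} {n : ℕ∞} (hN : ContDiff ℝ n N)
    (h : ContDiff ℝ (n + 1) φ) : ContDiff ℝ n fun p : E3 × ℝ => sdiv N φ p.1 p.2 :=
  ContDiff.sum fun j _ => contDiff_tder hN (contDiff_euclidean.1 h j) j

theorem contDiff_Pmat {N : E3 × ℝ → E3} {n : ℕ∞} (hN : ContDiff ℝ n N) (i j : Fin 3) :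
    ContDiff ℝ n fun p : E3 × ℝ => Pmat N p.1 p.2 i j :=
  contDiff_const.sub ((contDiff_apply₃ hN i).mul (contDiff_apply₃ hN j))

theorem contDiff_DGam {N φ : E3 × ℝ → E3} {n : ℕ∞} (hN : ContDiff ℝ n N)
    (h : ContDiff ℝ (n + 1) φ) (i j : Fin 3) :
    ContDiff ℝ n fun p : E3 × ℝ => DGam N φ p.1 p.2 i j := by
  have hD : ∀ k l, ContDiff ℝ n fun p : E3 × ℝ => Dmat φ p.1 p.2 k l := fun k l =>
    ((contDiff_pdx (contDiff_euclidean.1 h l) k).add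
      (contDiff_pdx (contDiff_euclidean.1 h k) l)).div_const 2
  simp only [DGam, Matrix.mul_apply]
  exact ContDiff.sum fun l _ => (ContDiff.sum fun k _ => (contDiff_Pmat hN i k).mul (hD k l)).mul
    (contDiff_Pmat hN l j)

theorem contDiff_frob2_DGam {N φ : E3 × ℝ → E3} {n : ℕ∞} (hN : ContDiff ℝ n N)
    (h : ContDiff ℝ (n + 1) φ) : ContDiff ℝ n fun p : E3 × ℝ => frob2 (DGam N φ p.1 p.2) :=
  ContDiff.sum fun i _ => ContDiff.sum fun j _ => (contDiff_DGam hN h i j).pow 2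

theorem contDiff_deriv_comp {X : Type*} [NormedAddCommGroup X] [NormedSpace ℝ X] {n : ℕ∞}
    {e : ℝ → ℝ} {f : X → ℝ} (he : ContDiff ℝ (n + 1) e) (hf : ContDiff ℝ n f) :
    ContDiff ℝ n fun x => deriv e (f x) :=
  (contDiff_succ_iff_deriv.1 he).2.2.comp hf

theorem contDiff_SGam {N v : E3 × ℝ → E3} {σ : E3 × ℝ → ℝ} {e₁ e₂ : ℝ → ℝ} {n : ℕ∞}
    (hN : ContDiff ℝ n N) (hv : ContDiff ℝ (n + 1) v) (hσ : ContDiff ℝ n σ)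
    (he₁ : ContDiff ℝ (n + 1) e₁) (he₂ : ContDiff ℝ (n + 1) e₂) (i j : Fin 3) :
    ContDiff ℝ n fun p : E3 × ℝ => SGam N v σ e₁ e₂ p.1 p.2 i j :=
  (((contDiff_deriv_comp he₁ (contDiff_frob2_DGam hN hv)).mul (contDiff_DGam hN hv i j)).add
    (((contDiff_deriv_comp he₂ ((contDiff_sdiv hN hv).pow 2)).mul (contDiff_sdiv hN hv)).mul
      (contDiff_Pmat hN i j))).sub (hσ.mul (contDiff_Pmat hN i j))

theorem contDiff_eDtilde {N v : E3 × ℝ → E3} {e₁ e₂ : ℝ → ℝ} {n : ℕ∞}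
    (hN : ContDiff ℝ n N) (hv : ContDiff ℝ (n + 1) v)
    (he₁ : ContDiff ℝ (n + 1) e₁) (he₂ : ContDiff ℝ (n + 1) e₂) :
    ContDiff ℝ n fun p : E3 × ℝ => eDtilde N v e₁ e₂ p.1 p.2 :=
  ((contDiff_deriv_comp he₁ (contDiff_frob2_DGam hN hv)).mul (contDiff_frob2_DGam hN hv)).add
    ((contDiff_deriv_comp he₂ ((contDiff_sdiv hN hv).pow 2)).mul ((contDiff_sdiv hN hv).pow 2))

theorem continuous_areaElem {xh : E2 × ℝ → E3} (h : ContDiff ℝ 1 xh) :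
    Continuous fun q : E2 × ℝ => areaElem xh q.1 q.2 := by
  have hg := fun α => contDiff_gVec (n := 0) (by simpa using h) α
  exact (contDiff_cross3 (hg 0) (hg 1)).continuous.norm

end Parametrization

section Kinematics

open Set Filter Topology

/-! ### Differentiation along the parametrization -/

theorem hasDerivAt_comp_path {φ : E3 × ℝ → ℝ} {γ : ℝ → E3} {τ : ℝ → ℝ} {w : E3} {r s : ℝ}
    (h : DifferentiableAt ℝ φ (γ s, τ s)) (hγ : HasDerivAt γ w s) (hτ : HasDerivAt τ r s) :
    HasDerivAt (fun u => φ (γ u, τ u))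
      ((∑ j, pdx j φ (γ s) (τ s) * w j) + r * pdt φ (γ s) (τ s)) s := by
  have h1 := h.hasFDerivAt.comp_hasDerivAt s (hγ.prodMk hτ)
  have hw : ((w, r) : E3 × ℝ) = (∑ j, w j • ((EuclideanSpace.single j 1, 0) : E3 × ℝ)) +
      r • ((0, 1) : E3 × ℝ) := by
    refine Prod.ext ?_ ?_
    · simp only [Prod.fst_add, Prod.fst_sum, Prod.smul_fst, smul_zero, add_zero]
      have := (EuclideanSpace.basisFun (Fin 3) ℝ).sum_repr w
      simpa using this.symm
    · simp [Prod.snd_sum]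
  refine h1.congr_deriv ?_
  rw [hw]
  simp only [map_add, map_sum, map_smul, smul_eq_mul, ← pdx_eq h, ← pdt_eq h, mul_comm]

theorem hasDerivAt_coordLine (α : Fin 2) (X : E2) :
    HasDerivAt (fun s : ℝ => X + s • EuclideanSpace.single α (1 : ℝ))
      (EuclideanSpace.single α (1 : ℝ)) 0 := by
  simpa using ((hasDerivAt_id (0 : ℝ)).smul_const (EuclideanSpace.single α (1 : ℝ))).const_add X

theorem hasDerivAt_xh_coordLine {xh : E2 × ℝ → E3} {X : E2} {t : ℝ}
    (h : DifferentiableAt ℝ xh (X, t)) (α : Fin 2) :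
    HasDerivAt (fun s : ℝ => xh (X + s • EuclideanSpace.single α 1, t)) (gVec xh α X t) 0 := by
  have h0 : DifferentiableAt ℝ xh ((fun s : ℝ => (X + s • EuclideanSpace.single α (1 : ℝ), t)) 0) :=
    by simpa using h
  have := h0.hasFDerivAt.comp_hasDerivAt 0
    ((hasDerivAt_coordLine α X).prodMk (hasDerivAt_const (0 : ℝ) t))
  simp only [zero_smul, add_zero] at this
  rwa [gVec_eq h]

/-- The chain rule in the coordinate directions. -/
theorem hasDerivAt_comp_coordLine {φ : E3 × ℝ → ℝ} {xh : E2 × ℝ → E3} (hφ : Differentiable ℝ φ)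
    (hxh : Differentiable ℝ xh) (X : E2) (t : ℝ) (α : Fin 2) :
    HasDerivAt (fun s : ℝ => φ (xh (X + s • EuclideanSpace.single α 1, t), t))
      (∑ j, pdx j φ (xh (X, t)) t * gVec xh α X t j) 0 := by
  have := hasDerivAt_comp_path (φ := φ) (τ := fun _ => t) (hφ _)
    (hasDerivAt_xh_coordLine (hxh (X, t)) α) (hasDerivAt_const 0 t)
  simpa using this

theorem hasDerivAt_fderiv_path {xh : E2 × ℝ → E3} (hxh : ContDiff ℝ 2 xh) {γ : ℝ → E2 × ℝ}
    {w : E2 × ℝ} {s : ℝ} (hγ : HasDerivAt γ w s) (z : E2 × ℝ) :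
    HasDerivAt (fun u => fderiv ℝ xh (γ u) z) (fderiv ℝ (fderiv ℝ xh) (γ s) w z) s := by
  have hd : Differentiable ℝ (fderiv ℝ xh) :=
    (hxh.fderiv_right (m := 1) (by norm_num)).differentiable one_ne_zero
  have := (hd (γ s)).hasFDerivAt.comp_hasDerivAt s hγ
  simpa using this.clm_apply (hasDerivAt_const s z)

theorem fderiv_fderiv_symm {xh : E2 × ℝ → E3} (hxh : ContDiff ℝ 2 xh) (q w z : E2 × ℝ) :
    fderiv ℝ (fderiv ℝ xh) q w z = fderiv ℝ (fderiv ℝ xh) q z w :=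
  (hxh.contDiffAt.isSymmSndFDerivAt (by simp)).eq w z

theorem exists_hasDerivAt_gVec_coordLine {xh : E2 × ℝ → E3} (hxh : ContDiff ℝ 2 xh) (X : E2)
    (t : ℝ) : ∃ d : E3,
      HasDerivAt (fun s : ℝ => gVec xh 1 (X + s • EuclideanSpace.single 0 1) t) d 0 ∧
      HasDerivAt (fun s : ℝ => gVec xh 0 (X + s • EuclideanSpace.single 1 1) t) d 0 := by
  have hd : Differentiable ℝ xh := hxh.differentiable two_ne_zero
  have key : ∀ α β : Fin 2,
      HasDerivAt (fun s : ℝ => gVec xh β (X + s • EuclideanSpace.single α 1) t)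
        (fderiv ℝ (fderiv ℝ xh) (X, t) (EuclideanSpace.single α 1, 0)
          (EuclideanSpace.single β 1, 0)) 0 := fun α β => by
    have := hasDerivAt_fderiv_path hxh
      ((hasDerivAt_coordLine α X).prodMk (hasDerivAt_const (0 : ℝ) t))
      (EuclideanSpace.single β 1, 0)
    simp only [zero_smul, add_zero] at this
    simpa only [gVec_eq (hd _)] using this
  exact ⟨_, key 0 1, fderiv_fderiv_symm hxh (X, t) _ _ ▸ key 1 0⟩

theorem hasDerivAt_apply₃ {f : ℝ → E3} {f' : E3} {s : ℝ} (h : HasDerivAt f f' s) (i : Fin 3) :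
    HasDerivAt (fun u => f u i) (f' i) s :=
  (EuclideanSpace.proj (𝕜 := ℝ) i).hasFDerivAt.comp_hasDerivAt s h

/-- The tangent vectors are transported by the velocity gradient. -/
theorem hasDerivAt_gVec_time {xh : E2 × ℝ → E3} (hxh : ContDiff ℝ 2 xh) {v : E3 × ℝ → E3}
    (hv : Differentiable ℝ v) {X : E2} {t : ℝ}
    (hflow : ∀ᶠ Y in 𝓝 X, deriv (fun s => xh (Y, s)) t = v (xh (Y, t), t)) (α : Fin 2)
    (i : Fin 3) :
    HasDerivAt (fun s => gVec xh α X s i)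
      (∑ j, pdx j (fun p => v p i) (xh (X, t)) t * gVec xh α X t j) t := by
  have hd : Differentiable ℝ xh := hxh.differentiable two_ne_zero
  have h1 := hasDerivAt_fderiv_path hxh
    ((hasDerivAt_const t X).prodMk (hasDerivAt_id t)) (EuclideanSpace.single α 1, 0)
  simp only [id] at h1
  rw [fderiv_fderiv_symm hxh] at h1
  have h2 := hasDerivAt_fderiv_path hxh
    ((hasDerivAt_coordLine α X).prodMk (hasDerivAt_const (0 : ℝ) t)) (0, 1)
  simp only [zero_smul, add_zero] at h2
  have htime : ∀ Y, fderiv ℝ xh (Y, t) (0, 1) = deriv (fun s => xh (Y, s)) t := fun Y =>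
    ((hd (Y, t)).hasFDerivAt.comp_hasDerivAt t
      ((hasDerivAt_const t Y).prodMk (hasDerivAt_id t))).deriv.symm
  have hlim : Tendsto (fun s : ℝ => X + s • EuclideanSpace.single α (1 : ℝ)) (𝓝 0) (𝓝 X) := by
    simpa using (hasDerivAt_coordLine α X).continuousAt.tendsto
  have h3 : (fun s : ℝ => v (xh (X + s • EuclideanSpace.single α 1, t), t)) =ᶠ[𝓝 0]
      fun s : ℝ => fderiv ℝ xh (X + s • EuclideanSpace.single α 1, t) (0, 1) := by
    filter_upwards [hlim.eventually hflow] with s hs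
    rw [htime, hs]
  have h4 := hasDerivAt_apply₃ (h2.congr_of_eventuallyEq h3) i
  have hvi : Differentiable ℝ fun p => v p i := differentiable_euclidean.1 hv i
  rw [← h4.unique (hasDerivAt_comp_coordLine hvi hd X t α)]
  simpa only [gVec_eq (hd _)] using hasDerivAt_apply₃ h1 i

/-- Along the flow, the time derivative is the material derivative. -/
theorem hasDerivAt_comp_flow {φ : E3 × ℝ → ℝ} (hφ : Differentiable ℝ φ) {xh : E2 × ℝ → E3}
    (hxh : Differentiable ℝ xh) {v : E3 × ℝ → E3} {X : E2} {t : ℝ}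
    (hflow : deriv (fun s => xh (X, s)) t = v (xh (X, t), t)) :
    HasDerivAt (fun s => φ (xh (X, s), s)) (Dt v φ (xh (X, t)) t) t := by
  have h1 : HasDerivAt (fun s => xh (X, s)) (v (xh (X, t), t)) t := by
    rw [← hflow]
    exact ((hxh (X, t)).comp t (by fun_prop : DifferentiableAt ℝ (fun s => (X, s)) t)).hasDerivAt
  refine (hasDerivAt_comp_path (hφ _) h1 (hasDerivAt_id t)).congr_deriv ?_
  simp only [Dt, id, one_mul, mul_comm]
  exact add_comm _ _

/-! ### Algebra of the moving frame -/

/-- Completeness of the frame `a, b, n`, where `n` is the unit normal to `a` and `b`. -/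
theorem sum_frame_eq {a b n : E3} {J : ℝ} (hab : cross3 a b = J • n) (hn : ‖n‖ = 1)
    (p : Fin 3 → Fin 3 → ℝ) :
    ∑ i, ((∑ j, p j i * a j) * cross3 b n i + (∑ j, p j i * b j) * cross3 n a i) =
      J * ∑ j, ∑ i, ((if i = j then (1 : ℝ) else 0) - n i * n j) * p i j := by
  have hn' : n 0 * n 0 + n 1 * n 1 + n 2 * n 2 = 1 := by
    have := norm_sq_eq_sum n
    rw [hn, Fin.sum_univ_three] at this
    linarith
  have h0 : a 1 * b 2 - a 2 * b 1 = J * n 0 := congrArg (fun c : E3 => c 0) hab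
  have h1 : a 2 * b 0 - a 0 * b 2 = J * n 1 := congrArg (fun c : E3 => c 1) hab
  have h2 : a 0 * b 1 - a 1 * b 0 = J * n 2 := congrArg (fun c : E3 => c 2) hab
  simp only [Fin.sum_univ_three, cross3_apply_zero, cross3_apply_one, cross3_apply_two,
    Fin.isValue, Fin.reduceEq, if_true, if_false]
  linear_combination
    ((p 0 0 + p 1 1 + p 2 2) * n 0 - (p 0 0 * n 0 + p 1 0 * n 1 + p 2 0 * n 2)) * h0
    + ((p 0 0 + p 1 1 + p 2 2) * n 1 - (p 0 1 * n 0 + p 1 1 * n 1 + p 2 1 * n 2)) * h1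
    + ((p 0 0 + p 1 1 + p 2 2) * n 2 - (p 0 2 * n 0 + p 1 2 * n 1 + p 2 2 * n 2)) * h2
    + J * (p 0 0 + p 1 1 + p 2 2) * hn'

end Kinematics

section StressPower

/-! ### Algebra of the surface stress tensor -/

theorem norm_eq_one_iff_sum {n : E3} : ‖n‖ = 1 ↔ ∑ i, n i * n i = 1 := by
  rw [← norm_sq_eq_sum, pow_eq_one_iff_of_nonneg (norm_nonneg n) two_ne_zero]

variable {N v : E3 × ℝ → E3} {x : E3} {t : ℝ}

theorem Pmat_eq (N : E3 × ℝ → E3) (x : E3) (t : ℝ) :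
    Pmat N x t = 1 - Matrix.vecMulVec (N (x, t)) (N (x, t)) := by
  ext i j
  simp [Pmat, Matrix.one_apply, Matrix.vecMulVec_apply]

theorem Pmat_transpose : (Pmat N x t).transpose = Pmat N x t := by
  rw [Pmat_eq, Matrix.transpose_sub, Matrix.transpose_vecMulVec, Matrix.transpose_one]

theorem Pmat_mulVec_normal (h : ‖N (x, t)‖ = 1) : (Pmat N x t).mulVec (N (x, t)) = 0 := by
  have hn : (N (x, t)).ofLp ⬝ᵥ (N (x, t)).ofLp = 1 := norm_eq_one_iff_sum.1 h
  rw [Pmat_eq, Matrix.sub_mulVec, Matrix.one_mulVec, Matrix.vecMulVec_mulVec, hn]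
  simp

theorem Pmat_mul_self (h : ‖N (x, t)‖ = 1) : Pmat N x t * Pmat N x t = Pmat N x t := by
  conv_lhs => rw [Pmat_eq N, Matrix.mul_sub, ← Pmat_eq, mul_one, Matrix.mul_vecMulVec,
    Pmat_mulVec_normal h]
  simp

theorem SGam_mulVec_normal (σ : E3 × ℝ → ℝ) (e₁ e₂ : ℝ → ℝ) (h : ‖N (x, t)‖ = 1) :
    (SGam N v σ e₁ e₂ x t).mulVec (N (x, t)) = 0 := by
  have hD : (DGam N v x t).mulVec (N (x, t)) = 0 := by
    rw [DGam, ← Matrix.mulVec_mulVec, Pmat_mulVec_normal h, Matrix.mulVec_zero]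
  rw [SGam, Matrix.sub_mulVec, Matrix.add_mulVec, Matrix.smul_mulVec, Matrix.smul_mulVec,
    Matrix.smul_mulVec, hD, Pmat_mulVec_normal h]
  simp

/-- The velocity gradient `(∂v_i/∂x_j)`. -/
def velGrad (v : E3 × ℝ → E3) (x : E3) (t : ℝ) : Matrix (Fin 3) (Fin 3) ℝ :=
  Matrix.of fun i j => pdx j (fun p => v p i) x t

theorem tder_eq_mul_apply (i j : Fin 3) :
    tder N j (fun p => v p i) x t = (velGrad v x t * Pmat N x t) i j := by
  simp only [tder, Matrix.mul_apply, velGrad, Pmat, Matrix.of_apply, mul_comm]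

theorem Dmat_eq : Dmat v x t = (1 / 2 : ℝ) • (velGrad v x t + (velGrad v x t).transpose) := by
  ext i j
  simp [Dmat, velGrad]
  ring

theorem DGam_transpose : (DGam N v x t).transpose = DGam N v x t := by
  rw [DGam, Dmat_eq]
  simp only [Matrix.transpose_mul, Pmat_transpose, Matrix.transpose_smul, Matrix.transpose_add,
    Matrix.transpose_transpose, mul_assoc, add_comm]

theorem frob2_eq_trace (M : Matrix (Fin 3) (Fin 3) ℝ) : frob2 M = (M.transpose * M).trace := by
  simp only [frob2, Matrix.trace, Matrix.diag, Matrix.mul_apply, Matrix.transpose_apply, pow_two]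
  exact Finset.sum_comm

theorem trace_DGam_mul (h : ‖N (x, t)‖ = 1) :
    ((DGam N v x t).transpose * (velGrad v x t * Pmat N x t)).trace = frob2 (DGam N v x t) := by
  set P := Pmat N x t with hP
  set D := DGam N v x t with hD
  set G := velGrad v x t
  have hPD : P * D = D := by
    rw [hD, DGam, ← mul_assoc, ← mul_assoc, Pmat_mul_self h]
  have hDP : D * P = D := by
    rw [hD, DGam, mul_assoc, Pmat_mul_self h]
  have hsymm : (D * G.transpose).trace = (D * G).trace := by
    rw [← Matrix.trace_transpose, Matrix.transpose_mul, Matrix.transpose_transpose,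
      DGam_transpose, Matrix.trace_mul_comm]
  have hDE : frob2 D = (D * Dmat v x t).trace := by
    rw [frob2_eq_trace, DGam_transpose]
    conv_lhs => rw [show D * D = D * (P * Dmat v x t * P) from rfl, ← mul_assoc, ← mul_assoc,
      Matrix.trace_mul_comm, ← mul_assoc, ← mul_assoc, hPD, hDP]
  rw [hDE, Dmat_eq, DGam_transpose, ← mul_assoc, Matrix.trace_mul_comm, ← mul_assoc, hPD,
    Matrix.mul_smul, Matrix.trace_smul, mul_add, Matrix.trace_add, hsymm, smul_eq_mul]
  ring

theorem trace_Pmat_mul (h : ‖N (x, t)‖ = 1) :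
    ((Pmat N x t).transpose * (velGrad v x t * Pmat N x t)).trace = sdiv N v x t := by
  rw [Pmat_transpose, Matrix.trace_mul_comm, mul_assoc, Pmat_mul_self h]
  simp only [sdiv, tder_eq_mul_apply]
  rfl

/-- The stress power `S_Γ : ∇_Γ v` is the dissipation minus the pressure work. -/
theorem sum_SGam_mul_tder (σ : E3 × ℝ → ℝ) (e₁ e₂ : ℝ → ℝ) (h : ‖N (x, t)‖ = 1) :
    ∑ j, ∑ i, SGam N v σ e₁ e₂ x t i j * tder N j (fun p => v p i) x t =
      eDtilde N v e₁ e₂ x t - sdiv N v x t * σ (x, t) := by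
  have htr : ∑ j, ∑ i, SGam N v σ e₁ e₂ x t i j * tder N j (fun p => v p i) x t =
      ((SGam N v σ e₁ e₂ x t).transpose * (velGrad v x t * Pmat N x t)).trace := by
    simp only [tder_eq_mul_apply]
    rfl
  rw [htr, SGam]
  simp only [Matrix.transpose_sub, Matrix.transpose_add, Matrix.transpose_smul, sub_mul, add_mul,
    Matrix.smul_mul, Matrix.trace_sub, Matrix.trace_add, Matrix.trace_smul, trace_DGam_mul h,
    trace_Pmat_mul h, smul_eq_mul, eDtilde]
  ring

/-- The tangential vector field `S_Γᵀ v`. -/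
def stressVec (N v : E3 × ℝ → E3) (σ : E3 × ℝ → ℝ) (e₁ e₂ : ℝ → ℝ) (p : E3 × ℝ) : E3 :=
  WithLp.toLp 2 fun j => ∑ i, SGam N v σ e₁ e₂ p.1 p.2 i j * v p i

theorem stressVec_apply (σ : E3 × ℝ → ℝ) (e₁ e₂ : ℝ → ℝ) (p : E3 × ℝ) (j : Fin 3) :
    stressVec N v σ e₁ e₂ p j = ∑ i, SGam N v σ e₁ e₂ p.1 p.2 i j * v p i := rfl

theorem sdivM_apply (M : E3 × ℝ → Matrix (Fin 3) (Fin 3) ℝ) (i : Fin 3) :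
    sdivM N M x t i = ∑ j, tder N j (fun p => M p i j) x t := rfl

theorem contDiff_stressVec {σ : E3 × ℝ → ℝ} {e₁ e₂ : ℝ → ℝ} (hN : ContDiff ℝ 1 N)
    (hv : ContDiff ℝ 2 v) (hσ : ContDiff ℝ 1 σ) (he₁ : ContDiff ℝ 2 e₁) (he₂ : ContDiff ℝ 2 e₂) :
    ContDiff ℝ 1 (stressVec N v σ e₁ e₂) := by
  have h2 : (2 : WithTop ℕ∞) = ((1 : ℕ∞) : WithTop ℕ∞) + 1 := by norm_num
  refine contDiff_euclidean.2 fun j => ?_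
  simp only [stressVec_apply]
  refine ContDiff.sum fun i _ => ContDiff.mul ?_ ?_
  · exact contDiff_SGam (n := 1) hN (h2 ▸ hv) hσ (h2 ▸ he₁) (h2 ▸ he₂) i j
  · exact contDiff_euclidean.1 (hv.of_le (by norm_num)) i

theorem stressVec_dot (σ : E3 × ℝ → ℝ) (e₁ e₂ : ℝ → ℝ) (w : E3) :
    ∑ j, stressVec N v σ e₁ e₂ (x, t) j * w j =
      ∑ i, v (x, t) i * (SGam N v σ e₁ e₂ x t).mulVec w i := by
  simp only [stressVec, Matrix.mulVec, dotProduct, Finset.sum_mul, Finset.mul_sum]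
  rw [Finset.sum_comm]
  exact Finset.sum_congr rfl fun i _ => Finset.sum_congr rfl fun j _ => by ring

theorem tder_sum_mul {ι : Type*} (s : Finset ι) {f g : ι → E3 × ℝ → ℝ}
    (hf : ∀ i, Differentiable ℝ (f i)) (hg : ∀ i, Differentiable ℝ (g i)) (j : Fin 3) :
    tder N j (fun p => ∑ i ∈ s, f i p * g i p) x t =
      ∑ i ∈ s, (tder N j (f i) x t * g i (x, t) + f i (x, t) * tder N j (g i) x t) := by
  have hpdx : ∀ k, pdx k (fun p => ∑ i ∈ s, f i p * g i p) x t =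
      ∑ i ∈ s, (pdx k (f i) x t * g i (x, t) + f i (x, t) * pdx k (g i) x t) := fun k => by
    have hd : ∀ i, HasFDerivAt (fun p => f i p * g i p) _ (x, t) := fun i =>
      (hf i (x, t)).hasFDerivAt.mul (hg i (x, t)).hasFDerivAt
    have hs := HasFDerivAt.fun_sum (u := s) fun i _ => hd i
    rw [pdx_eq hs.differentiableAt, hs.fderiv]
    simp only [sum_apply, add_apply,
      smul_apply, smul_eq_mul, pdx_eq (hf _ (x, t)), pdx_eq (hg _ (x, t))]
    exact Finset.sum_congr rfl fun i _ => by ring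
  simp only [tder, hpdx, Finset.mul_sum, Finset.sum_mul]
  rw [Finset.sum_comm]
  refine Finset.sum_congr rfl fun i _ => ?_
  rw [← Finset.sum_add_distrib]
  exact Finset.sum_congr rfl fun k _ => by ring

/-- The product rule for `div_Γ (S_Γᵀ v)`. -/
theorem sdiv_stressVec {σ : E3 × ℝ → ℝ} {e₁ e₂ : ℝ → ℝ} (hN : ContDiff ℝ 1 N)
    (hv : ContDiff ℝ 2 v) (hσ : ContDiff ℝ 1 σ) (he₁ : ContDiff ℝ 2 e₁) (he₂ : ContDiff ℝ 2 e₂)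
    (h : ‖N (x, t)‖ = 1) :
    sdiv N (stressVec N v σ e₁ e₂) x t =
      (∑ i, v (x, t) i * sdivM N (fun p => SGam N v σ e₁ e₂ p.1 p.2) x t i) +
        (eDtilde N v e₁ e₂ x t - sdiv N v x t * σ (x, t)) := by
  have h2 : (2 : WithTop ℕ∞) = ((1 : ℕ∞) : WithTop ℕ∞) + 1 := by norm_num
  have hS : ∀ j i, Differentiable ℝ fun p : E3 × ℝ => SGam N v σ e₁ e₂ p.1 p.2 i j := fun j i =>
    (contDiff_SGam (n := 1) hN (h2 ▸ hv) hσ (h2 ▸ he₁) (h2 ▸ he₂) i j).differentiable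
      one_ne_zero
  have hvi : ∀ i, Differentiable ℝ fun p => v p i :=
    differentiable_euclidean.1 (hv.differentiable two_ne_zero)
  rw [← sum_SGam_mul_tder σ e₁ e₂ h]
  simp only [sdiv, stressVec_apply,
    fun j => tder_sum_mul (N := N) (x := x) (t := t) Finset.univ (hS j) hvi j,
    Finset.sum_add_distrib]
  congr 1
  simp only [sdivM_apply, Finset.mul_sum]
  rw [Finset.sum_comm]
  exact Finset.sum_congr rfl fun i _ => Finset.sum_congr rfl fun j _ => mul_comm _ _

end StressPower

section Surface

open Set Filter Topology

/-! ### Transport of the area element and the surface divergence theorem -/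

theorem hasDerivAt_cross3_apply {a b : ℝ → E3} {a' b' : E3} {s : ℝ}
    (ha : ∀ i, HasDerivAt (fun u => a u i) (a' i) s)
    (hb : ∀ i, HasDerivAt (fun u => b u i) (b' i) s) (i : Fin 3) :
    HasDerivAt (fun u => cross3 (a u) (b u) i) (cross3 a' (b s) i + cross3 (a s) b' i) s := by
  fin_cases i
  · refine (((ha 1).mul (hb 2)).sub ((ha 2).mul (hb 1))).congr_deriv ?_
    simp only [Fin.zero_eta, cross3_apply_zero]
    ring
  · refine (((ha 2).mul (hb 0)).sub ((ha 0).mul (hb 2))).congr_deriv ?_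
    simp only [Fin.mk_one, cross3_apply_one]
    ring
  · refine (((ha 0).mul (hb 1)).sub ((ha 1).mul (hb 0))).congr_deriv ?_
    simp only [Fin.reduceFinMk, cross3_apply_two]
    ring

theorem sum_mul_cross3_eq_zero {a b c n : E3} (hn : ‖n‖ = 1) (ha : ∑ i, a i * n i = 0)
    (hb : ∑ i, b i * n i = 0) (hc : ∑ i, c i * n i = 0) : ∑ i, a i * cross3 b c i = 0 := by
  rw [norm_eq_one_iff_sum] at hn
  simp only [Fin.sum_univ_three, cross3_apply_zero, cross3_apply_one, cross3_apply_two] at *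
  linear_combination
    (-(a 0 * (b 1 * c 2 - b 2 * c 1) + a 1 * (b 2 * c 0 - b 0 * c 2)
      + a 2 * (b 0 * c 1 - b 1 * c 0))) * hn
    + (n 0 * (b 1 * c 2 - b 2 * c 1) + n 1 * (b 2 * c 0 - b 0 * c 2)
      + n 2 * (b 0 * c 1 - b 1 * c 0)) * ha
    + (n 0 * (c 1 * a 2 - c 2 * a 1) + n 1 * (c 2 * a 0 - c 0 * a 2)
      + n 2 * (c 0 * a 1 - c 1 * a 0)) * hb
    + (n 0 * (a 1 * b 2 - a 2 * b 1) + n 1 * (a 2 * b 0 - a 0 * b 2)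
      + n 2 * (a 0 * b 1 - a 1 * b 0)) * hc

theorem cross3_gVec_eq {xh : E2 × ℝ → E3} {X : E2} {t : ℝ} (h : 0 < Gdet xh X t) :
    cross3 (gVec xh 0 X t) (gVec xh 1 X t) = areaElem xh X t • nHat xh X t :=
  (smul_inv_smul₀ (areaElem_pos h).ne' _).symm

/-- The area element is transported by the surface divergence of the velocity. -/
theorem hasDerivAt_areaElem {xh : E2 × ℝ → E3} (hxh : ContDiff ℝ 2 xh) {N v : E3 × ℝ → E3}
    (hv : Differentiable ℝ v) {X : E2} {t : ℝ}
    (hflow : ∀ᶠ Y in 𝓝 X, deriv (fun s => xh (Y, s)) t = v (xh (Y, t), t))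
    (hG : 0 < Gdet xh X t) (hN : N (xh (X, t), t) = nHat xh X t)
    (hN1 : ‖N (xh (X, t), t)‖ = 1) :
    HasDerivAt (fun s => areaElem xh X s) (areaElem xh X t * sdiv N v (xh (X, t)) t) t := by
  set n := N (xh (X, t), t) with hn
  set J := areaElem xh X t with hJ
  have hJpos : 0 < J := areaElem_pos hG
  have hab : cross3 (gVec xh 0 X t) (gVec xh 1 X t) = J • n := by
    rw [hN, cross3_gVec_eq hG]
  set g' : Fin 2 → E3 := fun α => WithLp.toLp 2 fun i =>
    ∑ j, pdx j (fun p => v p i) (xh (X, t)) t * gVec xh α X t j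
  have hg : ∀ α i, HasDerivAt (fun s => gVec xh α X s i) (g' α i) t :=
    fun α i => hasDerivAt_gVec_time hxh hv hflow α i
  have hm := hasDerivAt_cross3_apply (hg 0) (hg 1)
  have hsq : HasDerivAt (fun s => ∑ i, cross3 (gVec xh 0 X s) (gVec xh 1 X s) i *
      cross3 (gVec xh 0 X s) (gVec xh 1 X s) i) _ t :=
    HasDerivAt.fun_sum fun i _ => (hm i).mul (hm i)
  simp only [← norm_sq_eq_sum] at hsq
  have hsqrt := hsq.sqrt (by exact (pow_pos hJpos 2).ne')
  simp only [Real.sqrt_sq (norm_nonneg _)] at hsqrt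
  refine hsqrt.congr_deriv ?_
  have hframe := sum_frame_eq hab hN1 fun i j => pdx i (fun p => v p j) (xh (X, t)) t
  have hdiv : sdiv N v (xh (X, t)) t = ∑ j, ∑ i, ((if i = j then (1 : ℝ) else 0) - n i * n j) *
    pdx i (fun p => v p j) (xh (X, t)) t := rfl
  rw [← hdiv] at hframe
  rw [← hframe, hab, show ‖J • n‖ = J by rw [norm_smul, hN1, Real.norm_of_nonneg hJpos.le, mul_one],
    div_eq_iff (by positivity)]
  have hg' : ∀ α i, ∑ j, pdx j (fun p => v p i) (xh (X, t)) t * gVec xh α X t j = g' α i :=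
    fun _ _ => rfl
  simp only [hg', Fin.sum_univ_three, cross3_apply_zero, cross3_apply_one, cross3_apply_two,
    PiLp.smul_apply, smul_eq_mul]
  ring

/-- The flux of `W` in the coordinates of the parameter domain. -/
def coordFlux (xh : E2 × ℝ → E3) (N W : E3 × ℝ → E3) (t : ℝ) (Y : E2) : E2 :=
  WithLp.toLp 2
    ![∑ i, W (xh (Y, t), t) i * cross3 (gVec xh 1 Y t) (N (xh (Y, t), t)) i,
      ∑ i, W (xh (Y, t), t) i * cross3 (N (xh (Y, t), t)) (gVec xh 0 Y t) i]

theorem coordFlux_zero (xh : E2 × ℝ → E3) (N W : E3 × ℝ → E3) (t : ℝ) (Y : E2) :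
    coordFlux xh N W t Y 0 =
      ∑ i, W (xh (Y, t), t) i * cross3 (gVec xh 1 Y t) (N (xh (Y, t), t)) i := rfl

theorem coordFlux_one (xh : E2 × ℝ → E3) (N W : E3 × ℝ → E3) (t : ℝ) (Y : E2) :
    coordFlux xh N W t Y 1 =
      ∑ i, W (xh (Y, t), t) i * cross3 (N (xh (Y, t), t)) (gVec xh 0 Y t) i := rfl

variable {xh : E2 × ℝ → E3} {N W : E3 × ℝ → E3}

theorem contDiff_coordFlux (hxh : ContDiff ℝ 2 xh) (hN : ContDiff ℝ 1 N) (hW : ContDiff ℝ 1 W)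
    (t : ℝ) : ContDiff ℝ 1 (coordFlux xh N W t) := by
  have h2 : (2 : WithTop ℕ∞) = ((1 : ℕ∞) : WithTop ℕ∞) + 1 := by norm_num
  have hx : ContDiff ℝ 1 fun Y : E2 => (xh (Y, t), t) :=
    ((hxh.of_le (by norm_num)).comp (contDiff_prodMk_left t)).prodMk contDiff_const
  have hg : ∀ α, ContDiff ℝ 1 fun Y => gVec xh α Y t := fun α =>
    (contDiff_gVec (n := 1) (h2 ▸ hxh) α).comp (contDiff_prodMk_left t)
  have hNx := hN.comp hx
  have hWi : ∀ i, ContDiff ℝ 1 fun Y => W (xh (Y, t), t) i :=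
    contDiff_euclidean.1 (hW.comp hx)
  refine contDiff_euclidean.2 (Fin.forall_fin_two.2 ⟨?_, ?_⟩)
  · simp only [coordFlux_zero]
    exact ContDiff.sum fun i _ => (hWi i).mul
      (contDiff_euclidean.1 (contDiff_cross3 (n := 1) (hg 1) hNx) i)
  · simp only [coordFlux_one]
    exact ContDiff.sum fun i _ => (hWi i).mul
      (contDiff_euclidean.1 (contDiff_cross3 (n := 1) hNx (hg 0)) i)

theorem fderiv_single_eq {f : E2 → ℝ} {X : E2} {α : Fin 2} {f' : ℝ} (hf : DifferentiableAt ℝ f X)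
    (h : HasDerivAt (fun s : ℝ => f (X + s • EuclideanSpace.single α 1)) f' 0) :
    fderiv ℝ f X (EuclideanSpace.single α 1) = f' := by
  have h0 : DifferentiableAt ℝ f ((fun s : ℝ => X + s • EuclideanSpace.single α (1 : ℝ)) 0) := by
    simpa using hf
  have := h0.hasFDerivAt.comp_hasDerivAt 0 (hasDerivAt_coordLine α X)
  simp only [zero_smul, add_zero] at this
  exact this.unique h

/-- The coordinate divergence of the flux of a tangential field is its surface divergence times
the area element. -/
theorem sum_fderiv_coordFlux (hxh : ContDiff ℝ 2 xh) (hN : ContDiff ℝ 1 N) (hW : ContDiff ℝ 1 W)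
    {X : E2} {t : ℝ} (hG : 0 < Gdet xh X t) (hNn : N (xh (X, t), t) = nHat xh X t)
    (hN1 : ∀ᶠ Y in 𝓝 X, ‖N (xh (Y, t), t)‖ = 1)
    (hWN : ∑ i, W (xh (X, t), t) i * N (xh (X, t), t) i = 0) :
    ∑ α : Fin 2, fderiv ℝ (fun Y => coordFlux xh N W t Y α) X (EuclideanSpace.single α 1) =
      areaElem xh X t * sdiv N W (xh (X, t)) t := by
  have hd : Differentiable ℝ xh := hxh.differentiable two_ne_zero
  have hψ : ∀ α, DifferentiableAt ℝ (fun Y => coordFlux xh N W t Y α) X := fun α =>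
    differentiable_euclidean.1 ((contDiff_coordFlux hxh hN hW t).differentiable one_ne_zero) α X
  have hNi := differentiable_euclidean.1 (hN.differentiable one_ne_zero)
  have hWi := differentiable_euclidean.1 (hW.differentiable one_ne_zero)
  set n := N (xh (X, t), t) with hn
  set J := areaElem xh X t with hJ
  have hJpos : 0 < J := areaElem_pos hG
  have hn1 : ‖n‖ = 1 := hN1.self_of_nhds
  have hab : cross3 (gVec xh 0 X t) (gVec xh 1 X t) = J • n := by
    rw [hNn, cross3_gVec_eq hG]
  obtain ⟨d, hd1, hd0⟩ := exists_hasDerivAt_gVec_coordLine hxh X t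
  set N' : Fin 2 → E3 := fun α => WithLp.toLp 2 fun i =>
    ∑ j, pdx j (fun p => N p i) (xh (X, t)) t * gVec xh α X t j
  set W' : Fin 2 → E3 := fun α => WithLp.toLp 2 fun i =>
    ∑ j, pdx j (fun p => W p i) (xh (X, t)) t * gVec xh α X t j
  have hN' : ∀ α i, HasDerivAt
      (fun s : ℝ => N (xh (X + s • EuclideanSpace.single α 1, t), t) i) (N' α i) 0 :=
    fun α i => hasDerivAt_comp_coordLine (hNi i) hd X t α
  have hW' : ∀ α i, HasDerivAt
      (fun s : ℝ => W (xh (X + s • EuclideanSpace.single α 1, t), t) i) (W' α i) 0 :=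
    fun α i => hasDerivAt_comp_coordLine (hWi i) hd X t α
  have hN'n : ∀ α, ∑ i, N' α i * n i = 0 := fun α => by
    have h1 : HasDerivAt (fun s : ℝ => ∑ i, N (xh (X + s • EuclideanSpace.single α 1, t), t) i *
        N (xh (X + s • EuclideanSpace.single α 1, t), t) i) _ 0 :=
      HasDerivAt.fun_sum fun i _ => (hN' α i).mul (hN' α i)
    have hlim : Tendsto (fun s : ℝ => X + s • EuclideanSpace.single α (1 : ℝ)) (𝓝 0) (𝓝 X) := by
      simpa using (hasDerivAt_coordLine α X).continuousAt.tendsto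
    have h2 : (fun s : ℝ => ∑ i, N (xh (X + s • EuclideanSpace.single α 1, t), t) i *
        N (xh (X + s • EuclideanSpace.single α 1, t), t) i) =ᶠ[𝓝 0] fun _ => (1 : ℝ) := by
      filter_upwards [hlim.eventually hN1] with s hs using norm_eq_one_iff_sum.1 hs
    have h3 := h1.unique ((hasDerivAt_const (0 : ℝ) (1 : ℝ)).congr_of_eventuallyEq h2)
    simp only [zero_smul, add_zero, ← hn] at h3
    simp only [Fin.sum_univ_three] at h3 ⊢
    linarith
  have hgn : ∀ α, ∑ i, gVec xh α X t i * n i = 0 := fun α => by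
    have h0 := congrArg (fun c : E3 => c 0) hab
    have h1 := congrArg (fun c : E3 => c 1) hab
    have h2 := congrArg (fun c : E3 => c 2) hab
    simp only [cross3_apply_zero, cross3_apply_one, cross3_apply_two, PiLp.smul_apply,
      smul_eq_mul] at h0 h1 h2
    refine (mul_eq_zero.1 ?_).resolve_left hJpos.ne'
    rw [Fin.sum_univ_three]
    fin_cases α
    · simp only [Fin.zero_eta]
      linear_combination (-gVec xh 0 X t 0) * h0 - gVec xh 0 X t 1 * h1 - gVec xh 0 X t 2 * h2
    · simp only [Fin.mk_one]
      linear_combination (-gVec xh 1 X t 0) * h0 - gVec xh 1 X t 1 * h1 - gVec xh 1 X t 2 * h2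
  have hψ0 := HasDerivAt.fun_sum (u := Finset.univ) fun i _ => (hW' 0 i).mul
      (hasDerivAt_cross3_apply (hasDerivAt_apply₃ hd1) (hN' 0) i)
  have hψ1 := HasDerivAt.fun_sum (u := Finset.univ) fun i _ => (hW' 1 i).mul
      (hasDerivAt_cross3_apply (hN' 1) (hasDerivAt_apply₃ hd0) i)
  rw [Fin.sum_univ_two, fderiv_single_eq (hψ 0) hψ0, fderiv_single_eq (hψ 1) hψ1]
  simp only [zero_smul, add_zero, ← hn]
  have hframe := sum_frame_eq hab hn1 fun i j => pdx i (fun p => W p j) (xh (X, t)) t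
  have hdiv : sdiv N W (xh (X, t)) t = ∑ j, ∑ i, ((if i = j then (1 : ℝ) else 0) - n i * n j) *
    pdx i (fun p => W p j) (xh (X, t)) t := rfl
  rw [← hdiv] at hframe
  have hg' : ∀ α i, ∑ j, pdx j (fun p => W p i) (xh (X, t)) t * gVec xh α X t j = W' α i :=
    fun _ _ => rfl
  simp only [hg'] at hframe
  rw [← hframe]
  have h1 := sum_mul_cross3_eq_zero hn1 hWN (hgn 1) (hN'n 0)
  have h2 := sum_mul_cross3_eq_zero hn1 hWN (hN'n 1) (hgn 0)
  simp only [Fin.sum_univ_three, cross3_apply_zero, cross3_apply_one, cross3_apply_two]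
    at h1 h2 ⊢
  linear_combination h1 + h2

theorem dot2_coordFlux (t : ℝ) (X m : E2) :
    dot2 (coordFlux xh N W t X) m = ∑ i, W (xh (X, t), t) i *
      cross3 (m 0 • gVec xh 1 X t - m 1 • gVec xh 0 X t) (N (xh (X, t), t)) i := by
  simp only [dot2, Fin.sum_univ_two, coordFlux_zero, coordFlux_one, Fin.sum_univ_three,
    cross3_apply_zero, cross3_apply_one, cross3_apply_two, PiLp.sub_apply, PiLp.smul_apply,
    smul_eq_mul]
  ring

theorem cross3_smul_left (c : ℝ) (a b : E3) : cross3 (c • a) b = c • cross3 a b := by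
  ext i
  fin_cases i <;>
    simp [cross3_apply_zero, cross3_apply_one, cross3_apply_two] <;> ring

theorem cross3_eq_norm_smul_conormal (nU : E2 → E2) {X : E2} {t : ℝ}
    (hNn : N (xh (X, t), t) = nHat xh X t) :
    cross3 (nU X 0 • gVec xh 1 X t - nU X 1 • gVec xh 0 X t) (N (xh (X, t), t)) =
      ‖nU X 0 • gVec xh 1 X t - nU X 1 • gVec xh 0 X t‖ • conormal xh nU X t := by
  rw [conormal, ← cross3_smul_left, hNn]
  rcases eq_or_ne (nU X 0 • gVec xh 1 X t - nU X 1 • gVec xh 0 X t) 0 with h | h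
  · simp [h]
  · rw [smul_inv_smul₀ (norm_ne_zero_iff.2 h)]

/-- The normal of the parametrized surface extends continuously to the boundary. -/
theorem eq_nHat_of_mem_closure (hxh : ContDiff ℝ 1 xh) (hN : Continuous N) {U : Set E2} {t : ℝ}
    (hNs : ∀ X ∈ U, N (xh (X, t), t) = nHat xh X t) {X : E2} (hX : X ∈ closure U)
    (hG : 0 < Gdet xh X t) : N (xh (X, t), t) = nHat xh X t := by
  have hg : ∀ α, Continuous fun Y : E2 => gVec xh α Y t := fun α =>
    (contDiff_gVec (n := 0) (by simpa using hxh) α).continuous.comp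
      (continuous_id.prodMk continuous_const)
  have hc : Continuous fun Y : E2 => cross3 (gVec xh 0 Y t) (gVec xh 1 Y t) :=
    (contDiff_cross3 (n := 0) (contDiff_zero.2 (hg 0)) (contDiff_zero.2 (hg 1))).continuous
  have hn : ContinuousAt (fun Y => nHat xh Y t) X :=
    (hc.norm.continuousAt.inv₀ (areaElem_pos hG).ne').smul hc.continuousAt
  have hNx : ContinuousAt (fun Y => N (xh (Y, t), t)) X :=
    (hN.comp ((hxh.continuous.comp (continuous_id.prodMk continuous_const)).prodMk
      continuous_const)).continuousAt
  have : (𝓝[U] X).NeBot := mem_closure_iff_nhdsWithin_neBot.1 hX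
  refine tendsto_nhds_unique (l := 𝓝[U] X) (hNx.tendsto.mono_left nhdsWithin_le_nhds)
    ((hn.tendsto.mono_left nhdsWithin_le_nhds).congr' ?_)
  exact eventually_nhdsWithin_of_forall fun Y hY => (hNs Y hY).symm

/-- The **surface divergence theorem** for a tangential field with vanishing boundary flux. -/
theorem setIntegral_areaElem_mul_sdiv_eq_zero (hxh : ContDiff ℝ 2 xh) (hN : ContDiff ℝ 1 N)
    (hW : ContDiff ℝ 1 W) {U : Set E2} (hU : IsOpen U) {nU : E2 → E2}
    (hnU : IsUnitOuterNormal U nU) {t : ℝ} (hG : ∀ X ∈ closure U, 0 < Gdet xh X t)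
    (hNs : ∀ X ∈ U, N (xh (X, t), t) = nHat xh X t)
    (hN1 : ∀ X ∈ U, ‖N (xh (X, t), t)‖ = 1)
    (hWN : ∀ X ∈ U, ∑ i, W (xh (X, t), t) i * N (xh (X, t), t) i = 0)
    (hflux : ∀ᵐ X ∂((μH[1] : Measure E2).restrict (frontier U)),
      ∑ i, W (xh (X, t), t) i * conormal xh nU X t i = 0) :
    ∫ X in U, areaElem xh X t * sdiv N W (xh (X, t)) t = 0 := by
  have hdiv := hnU.2 _ (contDiff_coordFlux hxh hN hW t)
  have hbdry : ∫ X in frontier U, dot2 (coordFlux xh N W t X) (nU X) ∂(μH[1] : Measure E2) = 0 := by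
    refine integral_eq_zero_of_ae ?_
    filter_upwards [hflux, ae_restrict_mem isClosed_frontier.measurableSet] with X hX hXf
    have hXc := frontier_subset_closure hXf
    have hNX := eq_nHat_of_mem_closure (hxh.of_le (by norm_num)) hN.continuous hNs hXc (hG X hXc)
    rw [dot2_coordFlux, cross3_eq_norm_smul_conormal nU hNX]
    simp only [PiLp.smul_apply, smul_eq_mul, Pi.zero_apply, mul_left_comm _ ‖_‖,
      ← Finset.mul_sum, hX, mul_zero]
  rw [← hdiv.trans hbdry]
  refine setIntegral_congr_fun hU.measurableSet fun X hX => ?_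
  exact (sum_fderiv_coordFlux hxh hN hW (hG X (subset_closure hX)) (hNs X hX)
    (Filter.mem_of_superset (hU.mem_nhds hX) fun Y hY => hN1 Y hY) (hWN X hX)).symm

end Surface

section Energy

open Set Filter Topology

/-! ### The balance of kinetic energy -/

theorem Bornology.IsBounded.integrableOn_of_continuous {U : Set E2} (hb : Bornology.IsBounded U)
    {f : E2 → ℝ} (hf : Continuous f) : IntegrableOn f U :=
  (hf.continuousOn.integrableOn_compact hb.isCompact_closure).mono_set subset_closure

theorem continuous_setIntegral {U : Set E2} (hb : Bornology.IsBounded U)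
    {k : E2 × ℝ → ℝ} (hk : Continuous k) : Continuous fun t => ∫ X in U, k (X, t) := by
  have h := continuous_parametric_integral_of_continuous (μ := volume.restrict U)
    (f := fun t X => k (X, t)) (by fun_prop) hb.isCompact_closure
  simpa only [Measure.restrict_restrict isClosed_closure.measurableSet,
    inter_eq_right.2 (subset_closure (s := U))] using h

theorem intervalIntegral_setIntegral_eq_sub {U : Set E2} (hU : IsOpen U)
    (hb : Bornology.IsBounded U) {K k : E2 × ℝ → ℝ} (hK : Continuous K) (hk : Continuous k)
    {a b : ℝ} (h : ∀ X ∈ U, ∀ t ∈ uIcc a b, HasDerivAt (fun s => K (X, s)) (k (X, t)) t) :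
    ∫ t in a..b, ∫ X in U, k (X, t) = (∫ X in U, K (X, b)) - ∫ X in U, K (X, a) := by
  have hint : Integrable (Function.uncurry fun (t : ℝ) X => k (X, t))
      ((volume.restrict (uIoc a b)).prod (volume.restrict U)) := by
    rw [Measure.prod_restrict]
    refine IntegrableOn.mono_set (t := uIcc a b ×ˢ closure U) ?_
      (prod_mono uIoc_subset_uIcc subset_closure)
    exact (hk.comp continuous_swap).continuousOn.integrableOn_compact
      (isCompact_uIcc.prod hb.isCompact_closure)
  rw [intervalIntegral_integral_swap hint,
    ← integral_sub (hb.integrableOn_of_continuous (by fun_prop))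
      (hb.integrableOn_of_continuous (by fun_prop))]
  exact setIntegral_congr_fun hU.measurableSet fun X hX =>
    intervalIntegral.integral_eq_sub_of_hasDerivAt (h X hX)
      ((hk.comp (by fun_prop : Continuous fun t : ℝ => (X, t))).intervalIntegrable a b)

/-- Pointwise balance of the kinetic energy along the flow. -/
theorem hasDerivAt_kineticEnergy {xh : E2 × ℝ → E3} (hxh : ContDiff ℝ 2 xh)
    {N v F : E3 × ℝ → E3} {ρ σ : E3 × ℝ → ℝ} {e₁ e₂ : ℝ → ℝ} (hN : ContDiff ℝ 1 N)
    (hv : ContDiff ℝ 2 v) (hρ : ContDiff ℝ 1 ρ) (hσ : ContDiff ℝ 1 σ) (he₁ : ContDiff ℝ 2 e₁)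
    (he₂ : ContDiff ℝ 2 e₂) {X : E2} {t : ℝ}
    (hflow : ∀ᶠ Y in 𝓝 X, deriv (fun s => xh (Y, s)) t = v (xh (Y, t), t))
    (hG : 0 < Gdet xh X t) (hNX : N (xh (X, t), t) = nHat xh X t)
    (hN1 : ‖N (xh (X, t), t)‖ = 1)
    (hcont : Dt v ρ (xh (X, t)) t + sdiv N v (xh (X, t)) t * ρ (xh (X, t), t) = 0)
    (hmom : ∀ i, ρ (xh (X, t), t) * Dt v (fun p => v p i) (xh (X, t)) t =
      sdivM N (fun p => SGam N v σ e₁ e₂ p.1 p.2) (xh (X, t)) t i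
        + ρ (xh (X, t), t) * F (xh (X, t), t) i) :
    HasDerivAt (fun s => areaElem xh X s *
        ((1 / 2) * ρ (xh (X, s), s) * ‖v (xh (X, s), s)‖ ^ 2))
      (areaElem xh X t * (sdiv N (stressVec N v σ e₁ e₂) (xh (X, t)) t
        - eDtilde N v e₁ e₂ (xh (X, t)) t
        + (sdiv N v (xh (X, t)) t * σ (xh (X, t), t)
          + ρ (xh (X, t), t) * dot3 (F (xh (X, t), t)) (v (xh (X, t), t))))) t := by
  have hxd : Differentiable ℝ xh := hxh.differentiable two_ne_zero
  have hvd : Differentiable ℝ v := hv.differentiable two_ne_zero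
  have hJ := hasDerivAt_areaElem hxh hvd hflow hG hNX hN1
  have hρ' := hasDerivAt_comp_flow (hρ.differentiable one_ne_zero) hxd hflow.self_of_nhds
  have hv' := fun i => hasDerivAt_comp_flow (differentiable_euclidean.1 hvd i) hxd
    hflow.self_of_nhds
  have hsq := HasDerivAt.fun_sum (u := Finset.univ) fun i _ => (hv' i).mul (hv' i)
  simp only [norm_sq_eq_sum]
  refine (hJ.mul ((hρ'.const_mul (1 / 2)).mul hsq)).congr_deriv ?_
  rw [sdiv_stressVec hN hv hσ he₁ he₂ hN1]
  have h0 := hmom 0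
  have h1 := hmom 1
  have h2 := hmom 2
  simp only [dot3, Fin.sum_univ_three, Pi.mul_apply] at h0 h1 h2 ⊢
  linear_combination areaElem xh X t * (v (xh (X, t), t) 0 * h0 + v (xh (X, t), t) 1 * h1
    + v (xh (X, t), t) 2 * h2) + areaElem xh X t * (1 / 2) * (v (xh (X, t), t) 0 ^ 2
    + v (xh (X, t), t) 1 ^ 2 + v (xh (X, t), t) 2 ^ 2) * hcont

theorem sum_stressVec_mul_eq_zero {N v : E3 × ℝ → E3} {x w : E3} {t : ℝ} {σ : E3 × ℝ → ℝ}
    {e₁ e₂ : ℝ → ℝ} (h : mulVec3 (SGam N v σ e₁ e₂ x t) w = 0 ∨ v (x, t) = 0) :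
    ∑ j, stressVec N v σ e₁ e₂ (x, t) j * w j = 0 := by
  rw [stressVec_dot]
  refine Finset.sum_eq_zero fun i _ => ?_
  rcases h with h | h
  · rw [show (SGam N v σ e₁ e₂ x t).mulVec w i = 0 from congrArg (fun z : E3 => z i) h, mul_zero]
  · rw [h, PiLp.zero_apply, zero_mul]

theorem continuous_areaElem_mul {xh : E2 × ℝ → E3} (hxh : ContDiff ℝ 1 xh) {f : E3 × ℝ → ℝ}
    (hf : Continuous f) : Continuous fun q : E2 × ℝ => areaElem xh q.1 q.2 * f (xh q, q.2) :=
  (continuous_areaElem hxh).mul (hf.comp (hxh.continuous.prodMk continuous_snd))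

end Energy

/-- the energy law of the generalized compressible fluid system under
either the zero co-normal stress condition or the no-slip boundary condition. -/
theorem energy_law
    (T : ℝ) (hT : 0 < T)
    (U : Set E2) (hUopen : IsOpen U) (hUconn : IsConnected U) (hUbd : Bornology.IsBounded U)
    (nU : E2 → E2) (hnU : IsUnitOuterNormal U nU)
    (xh : E2 × ℝ → E3) (hxh : ContDiff ℝ 2 xh)
    (lam : ℝ) (hlam : 0 < lam)
    (hG : ∀ X ∈ closure U, ∀ t ∈ Set.Ico (0 : ℝ) T, lam ≤ Gdet xh X t)
    (hinj : ∀ t ∈ Set.Ico (0 : ℝ) T, Set.InjOn (fun X => xh (X, t)) (closure U))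
    (Γ : ℝ → Set E3) (hΓ : ∀ t, Γ t = (fun X => xh (X, t)) '' U)
    (bΓ : ℝ → Set E3) (hbΓ : ∀ t, bΓ t = (fun X => xh (X, t)) '' frontier U)
    (N : E3 × ℝ → E3) (hN : ContDiff ℝ 1 N)
    (hNs : ∀ X ∈ U, ∀ t ∈ Set.Ico (0 : ℝ) T, N (xh (X, t), t) = nHat xh X t)
    (hNnorm : ∀ t ∈ Set.Ico (0 : ℝ) T, ∀ x ∈ Γ t ∪ bΓ t, ‖N (x, t)‖ = 1)
    (v : E3 × ℝ → E3) (hv : ContDiff ℝ 2 v)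
    (hflow : ∀ X ∈ U, ∀ t ∈ Set.Ico (0 : ℝ) T,
      deriv (fun s => xh (X, s)) t = v (xh (X, t), t))
    (ρ σ : E3 × ℝ → ℝ) (hρ : ContDiff ℝ 2 ρ) (hσ : ContDiff ℝ 2 σ)
    (F : E3 × ℝ → E3) (hF : ContDiff ℝ 2 F)
    (e₁ e₂ : ℝ → ℝ) (he₁ : ContDiff ℝ 2 e₁) (he₂ : ContDiff ℝ 2 e₂)
    -- the continuity equation on Γ_T
    (hcont : ∀ t ∈ Set.Ioo (0 : ℝ) T, ∀ x ∈ Γ t,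
      Dt v ρ x t + sdiv N v x t * ρ (x, t) = 0)
    -- the momentum equation on Γ_T
    (hmom : ∀ t ∈ Set.Ioo (0 : ℝ) T, ∀ x ∈ Γ t, ∀ i : Fin 3,
      ρ (x, t) * Dt v (fun p => v p i) x t
        = sdivM N (fun p => SGam N v σ e₁ e₂ p.1 p.2) x t i + ρ (x, t) * F (x, t) i)
    -- boundary condition: zero co-normal stress, or no-slip
    (hbc : (∀ t ∈ Set.Ioo (0 : ℝ) T,
        ∀ᵐ X ∂((μH[1] : Measure E2).restrict (frontier U)),
          mulVec3 (SGam N v σ e₁ e₂ (xh (X, t)) t) (conormal xh nU X t) = 0) ∨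
      (∀ t ∈ Set.Ioo (0 : ℝ) T, ∀ x ∈ bΓ t, v (x, t) = 0)) :
    ∀ t₁ t₂ : ℝ, 0 < t₁ → t₁ < t₂ → t₂ < T →
      (∫ x in Γ t₂, (1 / 2) * ρ (x, t₂) * ‖v (x, t₂)‖ ^ 2 ∂(μH[2] : Measure E3))
          + (∫ τ in t₁..t₂, ∫ x in Γ τ, eDtilde N v e₁ e₂ x τ ∂(μH[2] : Measure E3))
        = (∫ x in Γ t₁, (1 / 2) * ρ (x, t₁) * ‖v (x, t₁)‖ ^ 2 ∂(μH[2] : Measure E3))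
          + ∫ τ in t₁..t₂, ∫ x in Γ τ,
              (sdiv N v x τ * σ (x, τ) + ρ (x, τ) * dot3 (F (x, τ)) (v (x, τ)))
                ∂(μH[2] : Measure E3) := by
  intro t₁ t₂ h₁ h₁₂ h₂
  have h2 : (2 : WithTop ℕ∞) = ((1 : ℕ∞) : WithTop ℕ∞) + 1 := by norm_num
  have hxh1 : ContDiff ℝ 1 xh := hxh.of_le (by norm_num)
  have hρ1 : ContDiff ℝ 1 ρ := hρ.of_le (by norm_num)
  have hσ1 : ContDiff ℝ 1 σ := hσ.of_le (by norm_num)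
  have hIco : ∀ t ∈ Set.Icc t₁ t₂, t ∈ Set.Ico (0 : ℝ) T := fun t ht =>
    ⟨h₁.le.trans ht.1, ht.2.trans_lt h₂⟩
  have hIoo : ∀ t ∈ Set.Icc t₁ t₂, t ∈ Set.Ioo (0 : ℝ) T := fun t ht =>
    ⟨h₁.trans_le ht.1, ht.2.trans_lt h₂⟩
  have hpos : ∀ X ∈ closure U, ∀ t ∈ Set.Icc t₁ t₂, 0 < Gdet xh X t := fun X hX t ht =>
    hlam.trans_le (hG X hX t (hIco t ht))
  have hmem : ∀ X ∈ U, ∀ t, xh (X, t) ∈ Γ t := fun X hX t =>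
    (hΓ t).symm ▸ Set.mem_image_of_mem _ hX
  have hN1 : ∀ X ∈ U, ∀ t ∈ Set.Icc t₁ t₂, ‖N (xh (X, t), t)‖ = 1 := fun X hX t ht =>
    hNnorm t (hIco t ht) _ (Or.inl (hmem X hX t))
  obtain ⟨c, hc⟩ := exists_setIntegral_surface
  have hsurf : ∀ t ∈ Set.Icc t₁ t₂, ∀ g : E3 → ℝ, ∫ x in Γ t, g x ∂(μH[2] : Measure E3) =
      c * ∫ X in U, areaElem xh X t * g (xh (X, t)) := fun t ht g => by
    rw [hΓ t]
    exact hc xh U t hxh1 hUopen ((hinj t (hIco t ht)).mono subset_closure)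
      (fun X hX => hpos X (subset_closure hX) t ht) g
  have hsurfInt : ∀ g : E3 → ℝ → ℝ, ∫ t in t₁..t₂, ∫ x in Γ t, g x t ∂(μH[2] : Measure E3) =
      c * ∫ t in t₁..t₂, ∫ X in U, areaElem xh X t * g (xh (X, t)) t := fun g => by
    rw [← intervalIntegral.integral_const_mul]
    exact intervalIntegral.integral_congr fun t ht => hsurf t (Set.uIcc_of_le h₁₂.le ▸ ht) _
  have hKc : Continuous fun q : E2 × ℝ =>
      areaElem xh q.1 q.2 * ((1 / 2) * ρ (xh q, q.2) * ‖v (xh q, q.2)‖ ^ 2) :=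
    continuous_areaElem_mul hxh1 (f := fun p => (1 / 2) * ρ p * ‖v p‖ ^ 2)
      ((continuous_const.mul hρ.continuous).mul (hv.continuous.norm.pow 2))
  have hsc : Continuous fun q : E2 × ℝ =>
      areaElem xh q.1 q.2 * sdiv N (stressVec N v σ e₁ e₂) (xh q) q.2 :=
    continuous_areaElem_mul hxh1 (contDiff_sdiv (n := 0) (hN.of_le (by norm_num))
      (by simpa using contDiff_stressVec hN hv hσ1 he₁ he₂)).continuous
  have hec : Continuous fun q : E2 × ℝ => areaElem xh q.1 q.2 * eDtilde N v e₁ e₂ (xh q) q.2 :=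
    continuous_areaElem_mul hxh1
      (contDiff_eDtilde (n := 1) hN (h2 ▸ hv) (h2 ▸ he₁) (h2 ▸ he₂)).continuous
  have hdot : Continuous fun p => dot3 (F p) (v p) :=
    continuous_finsetSum _ fun i _ =>
      (contDiff_euclidean.1 hF i).continuous.mul (contDiff_euclidean.1 hv i).continuous
  have hwc : Continuous fun q : E2 × ℝ => areaElem xh q.1 q.2 *
      (sdiv N v (xh q) q.2 * σ (xh q, q.2)
        + ρ (xh q, q.2) * dot3 (F (xh q, q.2)) (v (xh q, q.2))) :=
    continuous_areaElem_mul hxh1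
      (f := fun p => sdiv N v p.1 p.2 * σ p + ρ p * dot3 (F p) (v p))
      (((contDiff_sdiv (n := 1) hN (h2 ▸ hv)).continuous.mul hσ.continuous).add
        (hρ.continuous.mul hdot))
  have hdiv : ∀ t ∈ Set.Icc t₁ t₂,
      ∫ X in U, areaElem xh X t * sdiv N (stressVec N v σ e₁ e₂) (xh (X, t)) t = 0 := by
    intro t ht
    refine setIntegral_areaElem_mul_sdiv_eq_zero hxh hN (contDiff_stressVec hN hv hσ1 he₁ he₂)
      hUopen hnU (fun X hX => hpos X hX t ht) (fun X hX => hNs X hX t (hIco t ht))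
      (fun X hX => hN1 X hX t ht) (fun X hX => ?_) ?_
    · rw [stressVec_dot, SGam_mulVec_normal σ e₁ e₂ (hN1 X hX t ht)]
      simp
    · rcases hbc with hbc | hbc
      · filter_upwards [hbc t (hIoo t ht)] with X hX
        exact sum_stressVec_mul_eq_zero (Or.inl hX)
      · filter_upwards [ae_restrict_mem isClosed_frontier.measurableSet] with X hX
        exact sum_stressVec_mul_eq_zero
          (Or.inr (hbc t (hIoo t ht) _ ((hbΓ t).symm ▸ Set.mem_image_of_mem _ hX)))
  have hbal := intervalIntegral_setIntegral_eq_sub hUopen hUbd hKc ((hsc.sub hec).add hwc)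
    (a := t₁) (b := t₂) fun X hX t ht => by
      rw [Set.uIcc_of_le h₁₂.le] at ht
      refine (hasDerivAt_kineticEnergy (F := F) hxh hN hv hρ1 hσ1 he₁ he₂
        (Filter.mem_of_superset (hUopen.mem_nhds hX) fun Y hY => hflow Y hY t (hIco t ht))
        (hpos X (subset_closure hX) t ht) (hNs X hX t (hIco t ht)) (hN1 X hX t ht)
        (hcont t (hIoo t ht) _ (hmem X hX t))
        (hmom t (hIoo t ht) _ (hmem X hX t))).congr_deriv ?_
      simp only [Pi.add_apply, Pi.sub_apply, mul_add, mul_sub]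
  have hXc : ∀ t : ℝ, Continuous fun X : E2 => (X, t) := fun t => by fun_prop
  have hsplit : ∫ t in t₁..t₂, ∫ X in U,
      (areaElem xh X t * sdiv N (stressVec N v σ e₁ e₂) (xh (X, t)) t
        - areaElem xh X t * eDtilde N v e₁ e₂ (xh (X, t)) t
        + areaElem xh X t * (sdiv N v (xh (X, t)) t * σ (xh (X, t), t)
          + ρ (xh (X, t), t) * dot3 (F (xh (X, t), t)) (v (xh (X, t), t)))) =
      (∫ t in t₁..t₂, ∫ X in U, areaElem xh X t * (sdiv N v (xh (X, t)) t * σ (xh (X, t), t)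
          + ρ (xh (X, t), t) * dot3 (F (xh (X, t), t)) (v (xh (X, t), t)))) -
      ∫ t in t₁..t₂, ∫ X in U, areaElem xh X t * eDtilde N v e₁ e₂ (xh (X, t)) t := by
    rw [← intervalIntegral.integral_sub ((continuous_setIntegral hUbd hwc).intervalIntegrable _ _)
      ((continuous_setIntegral hUbd hec).intervalIntegrable _ _)]
    refine intervalIntegral.integral_congr fun t ht => ?_
    rw [Set.uIcc_of_le h₁₂.le] at ht
    have hs := hUbd.integrableOn_of_continuous (hsc.comp (hXc t))
    have he := hUbd.integrableOn_of_continuous (hec.comp (hXc t))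
    have hw := hUbd.integrableOn_of_continuous (hwc.comp (hXc t))
    refine (integral_add (hs.sub he) hw).trans ?_
    refine (congrArg (· + _) ((integral_sub hs he).trans (congrArg (· - _) (hdiv t ht)))).trans ?_
    simp only [Function.comp_def]
    ring
  rw [hsurf t₁ (Set.left_mem_Icc.2 h₁₂.le), hsurf t₂ (Set.right_mem_Icc.2 h₁₂.le),
    hsurfInt fun x t => eDtilde N v e₁ e₂ x t,
    hsurfInt fun x t => sdiv N v x t * σ (x, t) + ρ (x, t) * dot3 (F (x, t)) (v (x, t))]
  have henergy := hsplit.symm.trans hbal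
  dsimp only at henergy
  linear_combination (-c) * henergy
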